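/- Let λ ∈ ℂ, let X ⊆ ℂ ≅ ℝ² be an open set homeomorphic to ℝ², and let w : X → ℂ and ψ : X → X be smooth functions such that the weighted composition operator C_{w,ψ} : f ↦ w·(f∘ψ) is well-defined on E_λ(X) = {f : X → ℂ smooth : ∂_z̄ f = λ f on X}, i.e. maps E_λ(X) into itself. Equip E_λ(X) with the compact-open topology. Then the following are equivalent: (i) C_{w,ψ} is topologically mixing on E_λ(X); (ii) C_{w,ψ} is topologically weakly mixing on E_λ(X); (iii) w has no zeros, ψ is injective, ψ is holomorphic (∂_z̄ψ = 0 on X), and ψ has no fixed point. If moreover |w(x)| ≤ 1 for all x ∈ X, then (i)–(iii) are further equivalent to: (iv) C_{w,ψ} is hypercyclic on E_λ(X). -/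

import Mathlib

/-- Topological mixing. -/
def TopMixing {E : Type*} [TopologicalSpace E] (T : E → E) : Prop :=
  ∀ U V : Set E, IsOpen U → IsOpen V → U.Nonempty → V.Nonempty →
    ∃ M : ℕ, ∀ m : ℕ, M ≤ m → ((T^[m] '' U) ∩ V).Nonempty

/-- Topological weak mixing. -/
def TopWeaklyMixing {E : Type*} [TopologicalSpace E] (T : E → E) : Prop :=
  ∀ U₁ U₂ V₁ V₂ : Set E, IsOpen U₁ → IsOpen U₂ → IsOpen V₁ → IsOpen V₂ →
    U₁.Nonempty → U₂.Nonempty → V₁.Nonempty → V₂.Nonempty →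
    ∃ m : ℕ, 1 ≤ m ∧ ((T^[m] '' U₁) ∩ V₁).Nonempty ∧ ((T^[m] '' U₂) ∩ V₂).Nonempty

/-- Hypercyclicity: some orbit is dense. -/
def Hypercyclic {E : Type*} [TopologicalSpace E] (T : E → E) : Prop :=
  ∃ x : E, Dense (Set.range fun m : ℕ => T^[m] x)

/-- The Wirtinger derivative `∂_z̄ u = (1/2)(∂₁u + i ∂₂u)` of a function `u : ℂ → ℂ`,
where `ℂ` is identified with `ℝ²` via `z = x₁ + i x₂`. -/
noncomputable def dbar (u : ℂ → ℂ) : ℂ → ℂ :=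
  fun z => (1 / 2 : ℂ) * (fderiv ℝ u z 1 + Complex.I * fderiv ℝ u z Complex.I)

/-- The eigenspace `E_λ(X) = {f : X → ℂ smooth, ∂_z̄ f = λf}`, realized as the set of those
continuous functions on `X` (an open subset of `ℂ`) which agree on `X` with a function that is
smooth on `X` and satisfies `∂_z̄ g = λg` there. -/
def EigCR (lam : ℂ) (X : Set ℂ) : Set C(↥X, ℂ) :=
  {f | ∃ g : ℂ → ℂ, ContDiffOn ℝ (⊤ : ℕ∞) g X ∧
    (∀ z ∈ X, dbar g z = lam * g z) ∧ ∀ z : ↥X, f z = g ↑z}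

/-- The weighted composition operator `C_{w,ψ} f = w·(f∘ψ)` on `C(X, ℂ)` for `X ⊆ ℂ`. -/
noncomputable def wcompC (X : Set ℂ) (w ψ : ℂ → ℂ)
    (hw : ContinuousOn w X) (hψ : ContinuousOn ψ X) (hm : Set.MapsTo ψ X X) :
    C(↥X, ℂ) → C(↥X, ℂ) :=
  fun f => ⟨fun x => w ↑x * f ⟨ψ ↑x, hm x.2⟩, by
    exact (hw.restrict).mul (f.continuous.comp ((hψ.restrict).subtype_mk fun x => hm x.2))⟩

section

open Set Filter Topology Metric
open scoped ComplexConjugate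

/-- A locally uniform limit of zero-free holomorphic functions on a closed ball, itself zero-free on
the boundary circle, does not vanish at the centre. -/
theorem ne_zero_of_tendstoUniformlyOn_of_sphere {ι : Type*} {l : Filter ι} [l.NeBot]
    {F : ι → ℂ → ℂ} {f : ℂ → ℂ} {z₀ : ℂ} {r : ℝ} (hr : 0 < r)
    (hF : ∀ n, DiffContOnCl ℂ (F n) (ball z₀ r)) (hF0 : ∀ n, ∀ z ∈ closedBall z₀ r, F n z ≠ 0)
    (hlim : TendstoUniformlyOn F f l (closedBall z₀ r))
    (hf : ContinuousOn f (sphere z₀ r)) (hf0 : ∀ z ∈ sphere z₀ r, f z ≠ 0) : f z₀ ≠ 0 := by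
  have hne : (sphere z₀ r).Nonempty := NormedSpace.sphere_nonempty.mpr hr.le
  obtain ⟨w, hw, hmin⟩ := (isCompact_sphere z₀ r).exists_isMinOn hne hf.norm
  set m := ‖f w‖ with hm
  have hmpos : 0 < m := norm_pos_iff.mpr (hf0 w hw)
  intro h0
  obtain ⟨n, hn⟩ := ((Metric.tendstoUniformlyOn_iff.mp hlim) (m / 2) (by positivity)).exists
  have h1 : ∀ z ∈ sphere z₀ r, m / 2 ≤ ‖F n z‖ := by
    intro z hz
    have := hn z (sphere_subset_closedBall hz)
    have h2 : m ≤ ‖f z‖ := hmin hz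
    rw [dist_eq_norm] at this
    have := norm_sub_norm_le (f z) (F n z)
    linarith
  have hcl : closure (ball z₀ r) = closedBall z₀ r := closure_ball z₀ hr.ne'
  have h2 : DiffContOnCl ℂ (fun z => (F n z)⁻¹) (ball z₀ r) :=
    (hF n).inv fun z hz => hF0 n z (hcl ▸ hz)
  have h3 : ‖(F n z₀)⁻¹‖ ≤ (m / 2)⁻¹ := by
    refine Complex.norm_le_of_forall_mem_frontier_norm_le isBounded_ball h2 ?_
      (subset_closure (mem_ball_self hr))
    intro z hz
    rw [frontier_ball z₀ hr.ne'] at hz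
    rw [norm_inv]
    exact inv_anti₀ (by positivity) (h1 z hz)
  rw [norm_inv] at h3
  have h4 : m / 2 ≤ ‖F n z₀‖ :=
    (inv_le_inv₀ (norm_pos_iff.mpr (hF0 n z₀ (mem_closedBall_self hr.le))) (by positivity)).mp h3
  have h5 := hn z₀ (mem_closedBall_self hr.le)
  rw [h0, dist_zero_left] at h5
  linarith

/-- **Hurwitz's theorem**: a locally uniform limit of zero-free holomorphic functions on a
connected open set is zero-free or identically zero. -/
theorem eqOn_zero_of_tendstoLocallyUniformlyOn_of_ne_zero {ι : Type*} {l : Filter ι} [l.NeBot]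
    {F : ι → ℂ → ℂ} {f : ℂ → ℂ} {U : Set ℂ} (hU : IsOpen U) (hUc : IsPreconnected U)
    (hF : ∀ n, DifferentiableOn ℂ (F n) U) (hF0 : ∀ n, ∀ z ∈ U, F n z ≠ 0)
    (hlim : TendstoLocallyUniformlyOn F f l U) {z₀ : ℂ} (hz₀ : z₀ ∈ U) (h0 : f z₀ = 0) :
    EqOn f 0 U := by
  have hfd : DifferentiableOn ℂ f U := hlim.differentiableOn (Eventually.of_forall hF) hU
  have hfa : AnalyticOnNhd ℂ f U := hfd.analyticOnNhd hU
  rcases (hfa z₀ hz₀).eventually_eq_zero_or_eventually_ne_zero with h | h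
  · exact hfa.eqOn_zero_of_preconnected_of_eventuallyEq_zero hUc hz₀ h
  · exfalso
    rw [eventually_nhdsWithin_iff] at h
    obtain ⟨r, hr, hrU⟩ := (Metric.nhds_basis_closedBall.mem_iff).mp
      (Filter.inter_mem h (hU.mem_nhds hz₀))
    have hrU' : closedBall z₀ r ⊆ U := fun z hz => (hrU hz).2
    refine ne_zero_of_tendstoUniformlyOn_of_sphere (l := l) (F := F) (f := f) (z₀ := z₀) hr ?_
      (fun n z hz => hF0 n z (hrU' hz)) ?_
      (hfd.continuousOn.mono (sphere_subset_closedBall.trans hrU')) ?_ h0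
    · intro n
      refine DifferentiableOn.diffContOnCl ?_
      rw [closure_ball z₀ hr.ne']
      exact (hF n).mono hrU'
    · exact (tendstoLocallyUniformlyOn_iff_tendstoUniformlyOn_of_compact
        (isCompact_closedBall z₀ r)).mp (hlim.mono hrU')
    · intro z hz
      exact (hrU (sphere_subset_closedBall hz)).1 (ne_of_mem_sphere hz hr.ne')

/-- A locally uniform limit of injective holomorphic functions on a connected open set is injective
or constant. -/
theorem injOn_of_tendstoLocallyUniformlyOn {ι : Type*} {l : Filter ι} [l.NeBot]
    {F : ι → ℂ → ℂ} {f : ℂ → ℂ} {U : Set ℂ} (hU : IsOpen U) (hUc : IsPreconnected U)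
    (hF : ∀ n, DifferentiableOn ℂ (F n) U) (hFi : ∀ n, InjOn (F n) U)
    (hlim : TendstoLocallyUniformlyOn F f l U) (hconst : ∀ c, ¬ EqOn f (fun _ => c) U) :
    InjOn f U := by
  have hfd : DifferentiableOn ℂ f U := hlim.differentiableOn (Eventually.of_forall hF) hU
  intro a ha b hb hab
  by_contra hne
  obtain ⟨r, hr, hrU⟩ := Metric.isOpen_iff.mp
    (hU.inter (isOpen_compl_singleton (x := a))) b ⟨hb, fun h => hne h.symm⟩
  have hball : ball b r ⊆ U := fun z hz => (hrU hz).1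
  have key : EqOn (fun z => f z - f a) 0 (ball b r) := by
    refine eqOn_zero_of_tendstoLocallyUniformlyOn_of_ne_zero (l := l)
      (F := fun n z => F n z - F n a) isOpen_ball (convex_ball b r).isPreconnected
      (fun n => ((hF n).mono hball).sub_const _) ?_ ?_ (mem_ball_self hr) (by simp [hab])
    · intro n z hz h
      exact (hrU hz).2 (hFi n (hball hz) ha (sub_eq_zero.mp h))
    · have h1 := hlim.mono hball
      have h2 : Tendsto (fun n => F n a) l (𝓝 (f a)) := hlim.tendsto_at ha
      rw [Metric.tendstoLocallyUniformlyOn_iff] at h1 ⊢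
      intro ε hε x hx
      obtain ⟨t, ht, h⟩ := h1 (ε / 2) (by positivity) x hx
      refine ⟨t, ht, ?_⟩
      filter_upwards [h, (Metric.tendsto_nhds.mp h2) (ε / 2) (by positivity)] with n hn hn' y hy
      have h3 := hn y hy
      rw [dist_eq_norm] at h3 hn' ⊢
      calc ‖f y - f a - (F n y - F n a)‖ = ‖(f y - F n y) + (F n a - f a)‖ := by congr 1; ring
        _ ≤ _ := norm_add_le _ _
        _ < ε := by linarith
  refine hconst (f a) ?_
  have := (hfd.analyticOnNhd hU).eqOn_of_preconnected_of_eventuallyEq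
    (analyticOnNhd_const (v := f a)) hUc hb ?_
  · exact this
  · filter_upwards [ball_mem_nhds b hr] with z hz
    exact sub_eq_zero.mp (key hz)

/-- The derivative of an injective holomorphic function does not vanish. -/
theorem deriv_ne_zero_of_injOn {f : ℂ → ℂ} {U : Set ℂ} (hU : IsOpen U)
    (hf : DifferentiableOn ℂ f U) (hi : InjOn f U) {z₀ : ℂ} (hz₀ : z₀ ∈ U) : deriv f z₀ ≠ 0 := by
  intro h0
  obtain ⟨r, hr, hrU⟩ := Metric.isOpen_iff.mp hU z₀ hz₀
  have hr2 : 0 < r / 2 := by positivity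
  have hder : DifferentiableOn ℂ (deriv f) U := hf.deriv hU
  have hsub : ball z₀ (r / 2) ⊆ U := (ball_subset_ball (by linarith)).trans hrU
  have hmem : ∀ (n : ℕ), ∀ z ∈ ball z₀ (r / 2), ∀ t ∈ Icc (0 : ℝ) 1,
      z + (t * (r / (4 * (n + 1))) : ℝ) ∈ closedBall z₀ (3 * r / 4) := by
    intro n z hz t ht
    rw [mem_ball, dist_eq_norm] at hz
    rw [mem_closedBall, dist_eq_norm]
    have h1 : r / (4 * (n + 1)) ≤ r / 4 := by
      apply div_le_div_of_nonneg_left hr.le (by norm_num)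
      have : (0 : ℝ) ≤ n := n.cast_nonneg
      linarith
    have h2 : 0 ≤ r / (4 * ((n : ℝ) + 1)) := by positivity
    have h3 : t * (r / (4 * (n + 1))) ≤ r / 4 := by nlinarith [ht.1, ht.2]
    calc ‖z + (t * (r / (4 * (n + 1))) : ℝ) - z₀‖
        = ‖(z - z₀) + ((t * (r / (4 * (n + 1))) : ℝ) : ℂ)‖ := by congr 1; ring
      _ ≤ ‖z - z₀‖ + ‖((t * (r / (4 * (n + 1))) : ℝ) : ℂ)‖ := norm_add_le _ _
      _ ≤ r / 2 + r / 4 := by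
          gcongr
          rw [Complex.norm_real, Real.norm_of_nonneg (mul_nonneg ht.1 h2)]
          exact h3
      _ = 3 * r / 4 := by ring
  have hcl : closedBall z₀ (3 * r / 4) ⊆ U := (closedBall_subset_ball (by linarith)).trans hrU
  set e : ℕ → ℂ := fun n => ((r / (4 * (n + 1)) : ℝ) : ℂ) with he
  have he0 : ∀ n, e n ≠ 0 := by
    intro n
    simp only [he]
    exact_mod_cast (by positivity : r / (4 * ((n : ℝ) + 1)) ≠ 0)
  have hemem : ∀ n, ∀ z ∈ ball z₀ (r / 2), z + e n ∈ closedBall z₀ (3 * r / 4) := by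
    intro n z hz
    have := hmem n z hz 1 ⟨zero_le_one, le_rfl⟩
    rwa [one_mul] at this
  have helim : Tendsto (fun n => ‖e n‖) atTop (𝓝 0) := by
    have h1 : Tendsto (fun n : ℕ => (r / 4) * (1 / ((n : ℝ) + 1))) atTop (𝓝 ((r / 4) * 0)) :=
      tendsto_one_div_add_atTop_nhds_zero_nat.const_mul _
    rw [mul_zero] at h1
    refine h1.congr fun n => ?_
    simp only [he]
    rw [Complex.norm_real, Real.norm_of_nonneg (by positivity)]
    field_simp
  have hlim : TendstoLocallyUniformlyOn (fun n z => (f (z + e n) - f z) / e n) (deriv f) atTop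
      (ball z₀ (r / 2)) := by
    apply TendstoUniformlyOn.tendstoLocallyUniformlyOn
    rw [Metric.tendstoUniformlyOn_iff]
    intro ε hε
    have huc : UniformContinuousOn (deriv f) (closedBall z₀ (3 * r / 4)) :=
      (isCompact_closedBall _ _).uniformContinuousOn_of_continuous (hder.continuousOn.mono hcl)
    obtain ⟨δ, hδ, hδ'⟩ := Metric.uniformContinuousOn_iff.mp huc (ε / 2) (by positivity)
    filter_upwards [(tendsto_order.mp helim).2 δ hδ] with n hn z hz
    have hzc : z ∈ closedBall z₀ (3 * r / 4) := by
      have := hmem n z hz 0 ⟨le_rfl, zero_le_one⟩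
      simpa using this
    have hseg : segment ℝ z (z + e n) ⊆ closedBall z₀ (3 * r / 4) :=
      (convex_closedBall _ _).segment_subset hzc (hemem n z hz)
    have hmv : ‖(f (z + e n) - deriv f z * (z + e n)) - (f z - deriv f z * z)‖
        ≤ ε / 2 * ‖z + e n - z‖ := by
      refine (convex_segment z (z + e n)).norm_image_sub_le_of_norm_hasDerivWithin_le
        (f := fun y => f y - deriv f z * y) (f' := fun y => deriv f y - deriv f z) ?_ ?_
        (left_mem_segment ℝ _ _) (right_mem_segment ℝ _ _)
      · intro y hy
        have h1 : HasDerivAt f (deriv f y) y :=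
          (hf.differentiableAt (hU.mem_nhds (hcl (hseg hy)))).hasDerivAt
        have h2 : HasDerivAt (fun y => deriv f z * y) (deriv f z) y := by
          simpa using (hasDerivAt_id y).const_mul (deriv f z)
        exact (h1.sub h2).hasDerivWithinAt
      · intro y hy
        rw [← dist_eq_norm]
        refine (hδ' y (hseg hy) z hzc ?_).le
        rw [dist_eq_norm]
        refine lt_of_le_of_lt ?_ hn
        have := norm_sub_le_of_mem_segment hy
        simpa [norm_sub_rev] using this
    rw [dist_eq_norm]
    have hepos : 0 < ‖e n‖ := norm_pos_iff.mpr (he0 n)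
    have h3 : deriv f z - (f (z + e n) - f z) / e n =
        -(((f (z + e n) - deriv f z * (z + e n)) - (f z - deriv f z * z)) / e n) := by
      field_simp [he0 n]
      ring
    rw [h3, norm_neg, norm_div, div_lt_iff₀ hepos]
    refine hmv.trans_lt ?_
    rw [add_sub_cancel_left]
    nlinarith
  have hzero : EqOn (deriv f) 0 (ball z₀ (r / 2)) := by
    refine eqOn_zero_of_tendstoLocallyUniformlyOn_of_ne_zero isOpen_ball
      (convex_ball z₀ (r / 2)).isPreconnected ?_ ?_ hlim (mem_ball_self hr2) h0
    · intro n
      refine DifferentiableOn.div_const (DifferentiableOn.sub ?_ (hf.mono hsub)) _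
      exact hf.comp ((differentiableOn_id).add_const _) fun z hz => hcl (hemem n z hz)
    · intro n z hz h
      rw [div_eq_zero_iff, or_iff_left (he0 n), sub_eq_zero] at h
      have := hi (hcl (hemem n z hz)) (hsub hz) h
      exact he0 n (by simpa using this)
  have hz₁ : z₀ + e 0 / 2 ∈ ball z₀ (r / 2) := by
    rw [mem_ball, dist_eq_norm, add_sub_cancel_left]
    simp only [he, norm_div, Complex.norm_real]
    rw [Real.norm_of_nonneg (by positivity)]
    norm_num
    linarith
  have := isOpen_ball.is_const_of_deriv_eq_zero (convex_ball z₀ (r / 2)).isPreconnected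
    (hf.mono hsub) hzero hz₁ (mem_ball_self hr2)
  have := hi (hsub hz₁) hz₀ this
  exact he0 0 (by simpa using this)

/-- **Montel's theorem** along ultrafilters: a uniformly bounded family of holomorphic functions
converges locally uniformly along every ultrafilter. -/
theorem exists_tendstoLocallyUniformlyOn_of_ultrafilter {ι : Type*} (l : Ultrafilter ι)
    {F : ι → ℂ → ℂ} {U : Set ℂ} (hU : IsOpen U) (hF : ∀ n, DifferentiableOn ℂ (F n) U)
    (hb : ∀ n, ∀ z ∈ U, ‖F n z‖ ≤ 1) :
    ∃ f : ℂ → ℂ, TendstoLocallyUniformlyOn F f (l : Filter ι) U ∧ ∀ z ∈ U, ‖f z‖ ≤ 1 := by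
  have hpt : ∀ z ∈ U, ∃ c, ‖c‖ ≤ 1 ∧ Tendsto (fun n => F n z) l (𝓝 c) := by
    intro z hz
    have := (isCompact_closedBall (0 : ℂ) 1).ultrafilter_le_nhds (l.map fun n => F n z) (by
      rw [le_principal_iff, Ultrafilter.coe_map, Filter.mem_map]
      exact Filter.Eventually.of_forall fun n => by simpa using hb n z hz)
    obtain ⟨c, hc, hle⟩ := this
    exact ⟨c, by simpa using hc, hle⟩
  choose! f hf1 hf2 using hpt
  refine ⟨f, ?_, hf1⟩
  rw [Metric.tendstoLocallyUniformlyOn_iff]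
  intro ε hε x hx
  obtain ⟨r, hr, hrU⟩ := Metric.isOpen_iff.mp hU x hx
  have hsub : ∀ z ∈ ball x (r / 2), ball z (r / 2) ⊆ U := fun z hz =>
    (ball_subset_ball' (by rw [mem_ball] at hz; linarith)).trans hrU
  have hlip : ∀ n, ∀ y ∈ ball x (r / 2), dist (F n y) (F n x) ≤ 2 / (r / 2) * dist y x := by
    intro n y hy
    refine Complex.dist_le_div_mul_dist_of_mapsTo_ball
      ((hF n).mono (hsub x (mem_ball_self (by positivity)))) ?_ hy
    intro w hw
    rw [mem_closedBall, dist_eq_norm]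
    have h1 := hb n w (hsub x (mem_ball_self (by positivity)) hw)
    have h2 := hb n x hx
    linarith [norm_sub_le (F n w) (F n x)]
  have hlipf : ∀ y ∈ ball x (r / 2), dist (f y) (f x) ≤ 2 / (r / 2) * dist y x := by
    intro y hy
    have hyU : y ∈ U := hsub x (mem_ball_self (by positivity)) hy
    exact le_of_tendsto ((hf2 y hyU).dist (hf2 x hx)) (Eventually.of_forall fun n => hlip n y hy)
  set δ := min (r / 2) (ε * r / 16) with hδ
  have hδ0 : 0 < δ := by positivity
  refine ⟨ball x δ, mem_nhdsWithin_of_mem_nhds (ball_mem_nhds x hδ0), ?_⟩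
  filter_upwards [(Metric.tendsto_nhds.mp (hf2 x hx)) (ε / 4) (by positivity)] with n hn y hy
  have hy' : y ∈ ball x (r / 2) := ball_subset_ball (min_le_left _ _) hy
  have h1 := hlip n y hy'
  have h2 := hlipf y hy'
  have h3 : 2 / (r / 2) * dist y x ≤ ε / 4 := by
    have : dist y x ≤ ε * r / 16 := (mem_ball.mp hy).le.trans (min_le_right _ _)
    calc 2 / (r / 2) * dist y x ≤ 2 / (r / 2) * (ε * r / 16) := by gcongr
      _ = ε / 4 := by field_simp; norm_num
  have h4 := dist_triangle4 (f y) (f x) (F n x) (F n y)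
  rw [dist_comm (F n x) (f x)] at hn
  rw [dist_comm (F n x) (F n y)] at h4
  linarith

/-- Holomorphic square roots of zero-free holomorphic functions on simply connected open sets. -/
theorem exists_differentiableOn_sq_eq {U : Set ℂ} (hU : IsOpen U) (hUc : IsSimplyConnected U)
    {g : ℂ → ℂ} (hg : DifferentiableOn ℂ g U) (hg0 : ∀ z ∈ U, g z ≠ 0) :
    ∃ f : ℂ → ℂ, (∀ z ∈ U, HasDerivAt f (deriv g z / (2 * f z)) z) ∧ ∀ z, f z ^ 2 = g z := by
  obtain ⟨f, hfc, hf⟩ := Complex.exists_continuousOn_pow_eq hUc hU hg.continuousOn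
    (by rintro ⟨z, hz, h⟩; exact hg0 z hz h) two_ne_zero
  refine ⟨f, fun z hz => ?_, hf⟩
  have hfz : f z ≠ 0 := fun h => hg0 z hz (by rw [← hf z, h]; simp)
  have hc : ContinuousAt f z := hfc.continuousAt (hU.mem_nhds hz)
  have hgz : HasDerivAt g (deriv g z) z := (hg.differentiableAt (hU.mem_nhds hz)).hasDerivAt
  rw [hasDerivAt_iff_tendsto_slope] at hgz ⊢
  have h1 : Tendsto (fun y => f y + f z) (𝓝[≠] z) (𝓝 (2 * f z)) := by
    rw [two_mul]
    exact (hc.tendsto.mono_left nhdsWithin_le_nhds).add_const _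
  have h2 : ∀ᶠ y in 𝓝[≠] z, f y + f z ≠ 0 := h1.eventually_ne (by simpa using hfz)
  refine (hgz.div h1 (by simpa using hfz)).congr' ?_
  filter_upwards [h2] with y hy
  simp only [Pi.div_apply, slope_def_field]
  rw [← hf y, ← hf z, div_div, mul_comm, sq_sub_sq, mul_div_mul_left _ _ hy]

/-- Injective holomorphic functions on a connected open set are open maps. -/
theorem isOpen_image_of_injOn {U : Set ℂ} (hU : IsOpen U) {f : ℂ → ℂ}
    (hf : DifferentiableOn ℂ f U) (hi : InjOn f U) : IsOpen (f '' U) := by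
  rw [isOpen_iff_mem_nhds]
  rintro _ ⟨z, hz, rfl⟩
  have ha : AnalyticAt ℂ f z := hf.analyticAt (hU.mem_nhds hz)
  have := ha.hasStrictDerivAt.map_nhds_eq (deriv_ne_zero_of_injOn hU hf hi hz)
  rw [← this]
  exact image_mem_map (hU.mem_nhds hz)

/-- The inverse of an injective holomorphic function is holomorphic. -/
theorem differentiableOn_of_leftInverse {U : Set ℂ} (hU : IsOpen U) {f g : ℂ → ℂ}
    (hf : DifferentiableOn ℂ f U) (hi : InjOn f U) (hg : ∀ z ∈ U, g (f z) = z) :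
    DifferentiableOn ℂ g (f '' U) := by
  rintro _ ⟨z, hz, rfl⟩
  have ha : AnalyticAt ℂ f z := hf.analyticAt (hU.mem_nhds hz)
  have h0 := deriv_ne_zero_of_injOn hU hf hi hz
  exact (ha.hasStrictDerivAt.to_local_left_inverse h0
    (by filter_upwards [hU.mem_nhds hz] with y hy using hg y hy))
    |>.hasDerivAt.differentiableAt.differentiableWithinAt

/-- A proper simply connected open subset of `ℂ` embeds holomorphically in the unit disc. -/
theorem exists_injOn_mapsTo_ball {U : Set ℂ} (hU : IsOpen U) (hUc : IsSimplyConnected U)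
    (hne : U ≠ univ) :
    ∃ f : ℂ → ℂ, DifferentiableOn ℂ f U ∧ InjOn f U ∧ MapsTo f U (ball 0 1) := by
  obtain ⟨a, ha⟩ := (ne_univ_iff_exists_notMem U).mp hne
  have hz0 : ∀ z ∈ U, z - a ≠ 0 := fun z hz h => ha (sub_eq_zero.mp h ▸ hz)
  obtain ⟨f, hf, hf2⟩ := exists_differentiableOn_sq_eq hU hUc
    (differentiableOn_id.sub_const a) hz0
  have hfd : DifferentiableOn ℂ f U := fun z hz => (hf z hz).differentiableAt.differentiableWithinAt
  have hi : Function.Injective f := by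
    intro x y hxy
    have := hf2 x
    rw [hxy, hf2 y] at this
    simpa using this.symm
  obtain ⟨x, hx⟩ := hUc.nonempty
  obtain ⟨ε, hε, hball⟩ := Metric.isOpen_iff.mp (isOpen_image_of_injOn hU hfd hi.injOn) (f x)
    (mem_image_of_mem f hx)
  have hlow : ∀ z ∈ U, ε ≤ ‖f z + f x‖ := by
    intro z hz
    by_contra! h
    have : -f z ∈ ball (f x) ε := by
      rw [mem_ball, dist_eq_norm, ← norm_neg]
      simpa [add_comm] using h
    obtain ⟨y, hy, hyz⟩ := hball this
    have h1 : z = y := by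
      have h2 := hf2 y
      rw [hyz, neg_sq, hf2 z] at h2
      simpa using h2
    subst h1
    have h2 : f z = 0 := by linear_combination hyz / 2
    have h3 := hf2 z
    rw [h2] at h3
    exact hz0 z hz (by simpa using h3.symm)
  have hne0 : ∀ z ∈ U, f z + f x ≠ 0 := fun z hz h => by
    have := hlow z hz
    rw [h, norm_zero] at this
    linarith
  refine ⟨fun z => (ε / 2 : ℝ) / (f z + f x), ?_, ?_, ?_⟩
  · exact (differentiableOn_const _).div (hfd.add_const _) hne0
  · intro y hy z hz h
    have hc : ((ε / 2 : ℝ) : ℂ) ≠ 0 := by exact_mod_cast (by positivity)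
    rw [div_eq_div_iff (hne0 y hy) (hne0 z hz)] at h
    have := mul_left_cancel₀ hc h
    exact hi (by simpa using this.symm)
  · intro z hz
    have := hlow z hz
    rw [mem_ball_zero_iff, norm_div, Complex.norm_real, Real.norm_of_nonneg (by positivity),
      div_lt_one (by linarith)]
    linarith

/-- The Möbius automorphism of the unit disc sending `c` to `0`. -/
noncomputable def mob (c z : ℂ) : ℂ := (z - c) / (1 - conj c * z)

theorem mob_den_ne_zero {c z : ℂ} (hc : ‖c‖ < 1) (hz : ‖z‖ < 1) : 1 - conj c * z ≠ 0 := by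
  intro h
  have h1 : ‖conj c * z‖ = 1 := by rw [← sub_eq_zero.mp h, norm_one]
  rw [norm_mul, Complex.norm_conj] at h1
  nlinarith [norm_nonneg c, norm_nonneg z]

theorem norm_sq_mob_den_sub (c z : ℂ) :
    ‖1 - conj c * z‖ ^ 2 - ‖z - c‖ ^ 2 = (1 - ‖c‖ ^ 2) * (1 - ‖z‖ ^ 2) := by
  have h : ∀ w : ℂ, ((‖w‖ : ℝ) : ℂ) ^ 2 = w * conj w := fun w => (Complex.mul_conj' w).symm
  apply Complex.ofReal_injective
  push_cast
  simp only [h, map_sub, map_mul, map_one, Complex.conj_conj]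
  ring

theorem one_sub_norm_sq_mob {c z : ℂ} (hc : ‖c‖ < 1) (hz : ‖z‖ < 1) :
    1 - ‖mob c z‖ ^ 2 = (1 - ‖c‖ ^ 2) * (1 - ‖z‖ ^ 2) / ‖1 - conj c * z‖ ^ 2 := by
  have h0 : ‖1 - conj c * z‖ ≠ 0 := norm_ne_zero_iff.mpr (mob_den_ne_zero hc hz)
  rw [← norm_sq_mob_den_sub, mob, norm_div, div_pow, sub_div, div_self (pow_ne_zero 2 h0)]

theorem norm_mob_lt_one {c z : ℂ} (hc : ‖c‖ < 1) (hz : ‖z‖ < 1) : ‖mob c z‖ < 1 := by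
  have h0 : 0 < ‖1 - conj c * z‖ := norm_pos_iff.mpr (mob_den_ne_zero hc hz)
  have h := one_sub_norm_sq_mob hc hz
  have hc' : 0 < 1 - ‖c‖ ^ 2 := by nlinarith [norm_nonneg c]
  have hz' : 0 < 1 - ‖z‖ ^ 2 := by nlinarith [norm_nonneg z]
  have : 0 < 1 - ‖mob c z‖ ^ 2 := h ▸ by positivity
  nlinarith [norm_nonneg (mob c z)]

theorem mob_self (c : ℂ) : mob c c = 0 := by simp [mob]

theorem mob_neg_zero (c : ℂ) : mob (-c) 0 = c := by simp [mob]

theorem mob_neg_mob {c z : ℂ} (hc : ‖c‖ < 1) (hz : ‖z‖ < 1) : mob (-c) (mob c z) = z := by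
  have h1 := mob_den_ne_zero hc hz
  have h2 : 1 - conj c * c ≠ 0 := mob_den_ne_zero hc hc
  have h3 : 1 - conj (-c) * mob c z = (1 - conj c * c) / (1 - conj c * z) := by
    rw [mob, map_neg, eq_div_iff h1]
    field_simp
    ring
  have h4 : (z - c) / (1 - conj c * z) + c = z * (1 - conj c * c) / (1 - conj c * z) := by
    rw [div_add' _ _ _ h1]
    ring
  rw [mob, h3, mob, sub_neg_eq_add, h4, div_div_div_cancel_right₀ h1, mul_div_cancel_right₀ _ h2]

theorem mob_injOn {c : ℂ} (hc : ‖c‖ < 1) : InjOn (mob c) (ball 0 1) := by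
  intro x hx y hy h
  rw [mem_ball_zero_iff] at hx hy
  rw [← mob_neg_mob hc hx, h, mob_neg_mob hc hy]

theorem mob_mapsTo {c : ℂ} (hc : ‖c‖ < 1) : MapsTo (mob c) (ball 0 1) (ball 0 1) := by
  intro x hx
  rw [mem_ball_zero_iff] at hx ⊢
  exact norm_mob_lt_one hc hx

theorem hasDerivAt_mob {c z : ℂ} (hc : ‖c‖ < 1) (hz : ‖z‖ < 1) :
    HasDerivAt (mob c) ((1 - conj c * c) / (1 - conj c * z) ^ 2) z := by
  have h1 : HasDerivAt (fun z => z - c) 1 z := (hasDerivAt_id z).sub_const c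
  have h2 : HasDerivAt (fun z => 1 - conj c * z) (-(conj c)) z := by
    simpa using ((hasDerivAt_id z).const_mul (conj c)).const_sub 1
  have := h1.div h2 (mob_den_ne_zero hc hz)
  refine this.congr_deriv ?_
  congr 1
  ring

theorem mob_differentiableOn {c : ℂ} (hc : ‖c‖ < 1) : DifferentiableOn ℂ (mob c) (ball 0 1) :=
  fun _ hz => (hasDerivAt_mob hc (mem_ball_zero_iff.mp hz)).differentiableAt.differentiableWithinAt

theorem norm_mob_deriv {c z : ℂ} (hc : ‖c‖ < 1) (hz : ‖z‖ < 1) :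
    ‖(1 - conj c * c) / (1 - conj c * z) ^ 2‖ * (1 - ‖z‖ ^ 2) = 1 - ‖mob c z‖ ^ 2 := by
  rw [one_sub_norm_sq_mob hc hz, norm_div, norm_pow]
  have : 1 - conj c * c = ((1 - ‖c‖ ^ 2 : ℝ) : ℂ) := by
    push_cast
    rw [← Complex.mul_conj', mul_comm]
  rw [this, Complex.norm_real, Real.norm_of_nonneg (by nlinarith [norm_nonneg c])]
  ring

/-- If an injective holomorphic map into the disc misses a value of the disc, some other such map has
a larger derivative at a given point. -/
theorem exists_norm_deriv_lt_of_not_surjOn {U : Set ℂ} (hU : IsOpen U) (hUc : IsSimplyConnected U)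
    {f : ℂ → ℂ} (hf : DifferentiableOn ℂ f U) (hi : InjOn f U) (hm : MapsTo f U (ball 0 1))
    {w : ℂ} (hw : ‖w‖ < 1) (hwf : w ∉ f '' U) {a : ℂ} (ha : a ∈ U) :
    ∃ h : ℂ → ℂ, DifferentiableOn ℂ h U ∧ InjOn h U ∧ MapsTo h U (ball 0 1) ∧
      ‖deriv f a‖ < ‖deriv h a‖ := by
  have hm' : ∀ z ∈ U, ‖f z‖ < 1 := fun z hz => mem_ball_zero_iff.mp (hm hz)
  set p : ℂ → ℂ := fun z => mob w (f z) with hp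
  have hpd : DifferentiableOn ℂ p U := (mob_differentiableOn hw).comp hf hm
  have hp0 : ∀ z ∈ U, p z ≠ 0 := by
    intro z hz h
    simp only [hp, mob, div_eq_zero_iff, mob_den_ne_zero hw (hm' z hz), or_false, sub_eq_zero] at h
    exact hwf ⟨z, hz, h⟩
  obtain ⟨g, hg, hg2⟩ := exists_differentiableOn_sq_eq hU hUc hpd hp0
  have hgd : DifferentiableOn ℂ g U := fun z hz => (hg z hz).differentiableAt.differentiableWithinAt
  have hg1 : ∀ z ∈ U, ‖g z‖ < 1 := by
    intro z hz
    have h1 := norm_mob_lt_one hw (hm' z hz)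
    have h2 : ‖g z‖ ^ 2 = ‖p z‖ := by rw [← hg2, norm_pow]
    simp only [hp] at h2
    nlinarith [norm_nonneg (g z)]
  have hgm : MapsTo g U (ball 0 1) := fun z hz => mem_ball_zero_iff.mpr (hg1 z hz)
  have hgi : InjOn g U := by
    intro x hx y hy h
    have : p x = p y := by rw [← hg2, ← hg2, h]
    exact hi hx hy (mob_injOn hw (hm hx) (hm hy) this)
  have hs := hg1 a ha
  refine ⟨fun z => mob (g a) (g z), (mob_differentiableOn hs).comp hgd hgm,
    (mob_injOn hs).comp hgi hgm, (mob_mapsTo hs).comp hgm, ?_⟩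
  have hd1 : HasDerivAt (fun z => mob (g a) (g z)) _ a := (hasDerivAt_mob hs hs).comp a (hg a ha)
  have hd2 : HasDerivAt p _ a := (hasDerivAt_mob hw (hm' a ha)).comp a
    (hf.differentiableAt (hU.mem_nhds ha)).hasDerivAt
  have hga0 : g a ≠ 0 := fun h => hp0 a ha (by rw [← hg2, h]; simp)
  have hs0 : 0 < ‖g a‖ := norm_pos_iff.mpr hga0
  have hfa0 : 0 < ‖deriv f a‖ := norm_pos_iff.mpr (deriv_ne_zero_of_injOn hU hf hi ha)
  have e1 := norm_mob_deriv hw (hm' a ha)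
  have e2 := norm_mob_deriv hs hs
  have hp2 : ‖mob w (f a)‖ = ‖g a‖ ^ 2 := by rw [← norm_pow, hg2]
  rw [mob_self, norm_zero] at e2
  rw [hp2] at e1
  rw [hd1.deriv, hd2.deriv, norm_mul, norm_div _ (2 * g a),
    norm_mul _ (deriv f a), norm_mul 2 (g a), Complex.norm_ofNat]
  set A := ‖(1 - conj w * w) / (1 - conj w * f a) ^ 2‖
  set B := ‖(1 - conj (g a) * g a) / (1 - conj (g a) * g a) ^ 2‖
  set s := ‖g a‖
  have hs2 : 0 < 1 - s ^ 2 := by nlinarith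
  have hB : B = 1 / (1 - s ^ 2) := by rw [eq_div_iff hs2.ne', e2]; norm_num
  have hA : 1 - s ^ 4 ≤ A := by
    have : 0 ≤ A * ‖f a‖ ^ 2 := by positivity
    nlinarith
  rw [hB, ← mul_div_assoc, lt_div_iff₀ (by positivity), one_div, inv_mul_eq_div,
    lt_div_iff₀ hs2]
  have : (2 * s) * (1 - s ^ 2) < A := by
    refine lt_of_lt_of_le ?_ hA
    have : 0 < (1 - s ^ 2) * (1 - s) ^ 2 := by
      have : 0 < 1 - s := by linarith
      positivity
    nlinarith
  calc ‖deriv f a‖ * (2 * s) * (1 - s ^ 2) = ((2 * s) * (1 - s ^ 2)) * ‖deriv f a‖ := by ring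
    _ < A * ‖deriv f a‖ := by gcongr

/-- The **Riemann mapping theorem**. -/
theorem exists_bijOn_ball {U : Set ℂ} (hU : IsOpen U) (hUc : IsSimplyConnected U)
    (hne : U ≠ univ) :
    ∃ f : ℂ → ℂ, DifferentiableOn ℂ f U ∧ BijOn f U (ball 0 1) := by
  obtain ⟨a, ha⟩ := hUc.nonempty
  have hconn : IsPreconnected U := hUc.isPathConnected.isConnected.isPreconnected
  set S : Set ℝ := {t | ∃ f : ℂ → ℂ, (DifferentiableOn ℂ f U ∧ InjOn f U ∧ MapsTo f U (ball 0 1)) ∧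
    ‖deriv f a‖ = t} with hS
  have hSne : S.Nonempty := by
    obtain ⟨f, h1, h2, h3⟩ := exists_injOn_mapsTo_ball hU hUc hne
    exact ⟨_, f, ⟨h1, h2, h3⟩, rfl⟩
  obtain ⟨r, hr, hrU⟩ := Metric.isOpen_iff.mp hU a ha
  have hSb : BddAbove S := by
    refine ⟨2 / r, ?_⟩
    rintro _ ⟨f, ⟨h1, h2, h3⟩, rfl⟩
    refine Complex.norm_deriv_le_div_of_mapsTo_ball (h1.mono hrU) ?_ hr
    intro w hw
    have h4 := mem_ball_zero_iff.mp (h3 (hrU hw))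
    have h5 := mem_ball_zero_iff.mp (h3 ha)
    rw [mem_closedBall, dist_eq_norm]
    linarith [norm_sub_le (f w) (f a)]
  obtain ⟨u, -, hu, huS⟩ := exists_seq_tendsto_sSup hSne hSb
  choose F hF hFu using huS
  obtain ⟨f, hlim, hf1⟩ := exists_tendstoLocallyUniformlyOn_of_ultrafilter (hyperfilter ℕ) hU
    (fun n => (hF n).1) (fun n z hz => (mem_ball_zero_iff.mp ((hF n).2.2 hz)).le)
  have hfd : DifferentiableOn ℂ f U :=
    hlim.differentiableOn (Eventually.of_forall fun n => (hF n).1) hU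
  have hder : ‖deriv f a‖ = sSup S := by
    have h1 := ((hlim.deriv (Eventually.of_forall fun n => (hF n).1) hU).tendsto_at ha).norm
    have h2 : Tendsto u (hyperfilter ℕ) (𝓝 (sSup S)) :=
      hu.mono_left (Nat.hyperfilter_le_atTop)
    refine tendsto_nhds_unique h1 (h2.congr fun n => ?_)
    exact (hFu n).symm
  have hpos : 0 < sSup S := by
    obtain ⟨t, f, hf, rfl⟩ := hSne
    exact (norm_pos_iff.mpr (deriv_ne_zero_of_injOn hU hf.1 hf.2.1 ha)).trans_le
      (le_csSup hSb ⟨f, hf, rfl⟩)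
  have hinj : InjOn f U := by
    refine injOn_of_tendstoLocallyUniformlyOn hU hconn (fun n => (hF n).1)
      (fun n => (hF n).2.1) hlim fun c hc => ?_
    have : deriv f a = 0 := by
      have : f =ᶠ[𝓝 a] fun _ => c := by
        filter_upwards [hU.mem_nhds ha] with z hz using hc hz
      rw [this.deriv_eq, deriv_const]
    rw [this, norm_zero] at hder
    linarith
  have hmaps : MapsTo f U (ball 0 1) := by
    have h1 : f '' U ⊆ closedBall 0 1 := by
      rintro _ ⟨z, hz, rfl⟩
      simpa using hf1 z hz
    have h2 := interior_maximal h1 (isOpen_image_of_injOn hU hfd hinj)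
    rw [interior_closedBall _ one_ne_zero] at h2
    exact fun z hz => h2 (mem_image_of_mem f hz)
  refine ⟨f, hfd, hmaps, hinj, ?_⟩
  intro w hw
  by_contra hwf
  obtain ⟨h, h1, h2, h3, h4⟩ := exists_norm_deriv_lt_of_not_surjOn hU hUc hfd hinj hmaps
    (mem_ball_zero_iff.mp hw) hwf ha
  have := le_csSup hSb ⟨h, ⟨h1, h2, h3⟩, rfl⟩
  linarith

theorem tendsto_norm_iterate_of_linear_fractional {α β : ℂ} {f : ℂ → ℂ}
    (hd : ‖α‖ ^ 2 - ‖β‖ ^ 2 = 1)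
    (hf : ∀ z ∈ ball (0 : ℂ) 1, f z = (α * z + β) / (conj β * z + conj α))
    (hfix : ∀ z ∈ ball (0 : ℂ) 1, f z ≠ z) :
    Tendsto (fun n => ‖f^[n] 0‖) atTop (𝓝 1) := by
  have hαpos : 0 < ‖α‖ := by
    refine (norm_nonneg α).lt_of_ne fun h => ?_
    rw [← h] at hd
    nlinarith [sq_nonneg ‖β‖]
  have hαβ : ‖β‖ < ‖α‖ := by nlinarith [norm_nonneg β]
  have hden : ∀ z ∈ ball (0 : ℂ) 1, conj β * z + conj α ≠ 0 := by
    intro z hz h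
    rw [mem_ball_zero_iff] at hz
    have h1 : ‖conj β * z‖ = ‖conj α‖ := by
      rw [eq_neg_of_add_eq_zero_left h, norm_neg]
    rw [norm_mul, Complex.norm_conj, Complex.norm_conj] at h1
    nlinarith [norm_nonneg β, norm_nonneg z]
  have hd' : α * conj α - β * conj β = 1 := by
    rw [Complex.mul_conj', Complex.mul_conj']
    exact_mod_cast hd
  have hβ : β ≠ 0 := by
    rintro rfl
    exact hfix 0 (by simp) (by rw [hf 0 (by simp)]; simp)
  have hβpos : 0 < ‖β‖ := norm_pos_iff.mpr hβ
  have hcβ : conj β ≠ 0 := by simpa using hβ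
  have ht : 2 ≤ ‖α + conj α‖ := by
    by_contra! hlt
    have hre : ‖α + conj α‖ = 2 * |α.re| := by
      rw [Complex.add_conj]
      simp
    have hn : ‖α‖ ^ 2 = α.re ^ 2 + α.im ^ 2 := by
      rw [Complex.sq_norm, Complex.normSq_apply]; ring
    have h1 : |α.re| < 1 := by linarith
    have h2 : α.re ^ 2 < 1 := by
      rw [← sq_abs]; nlinarith [abs_nonneg α.re]
    have h3 : ‖β‖ ^ 2 < α.im ^ 2 := by linarith
    have h4 : ‖β‖ < |α.im| := by
      rw [← abs_of_pos hβpos]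
      exact sq_lt_sq.mp h3
    obtain ⟨y, hy, hyβ⟩ : ∃ y : ℝ, y ^ 2 - 2 * α.im * y + ‖β‖ ^ 2 = 0 ∧ |y| < ‖β‖ := by
      set s := √(α.im ^ 2 - ‖β‖ ^ 2)
      have hs : s ^ 2 = α.im ^ 2 - ‖β‖ ^ 2 := Real.sq_sqrt (by linarith)
      have hs0 : 0 ≤ s := Real.sqrt_nonneg _
      rcases le_total 0 α.im with h | h
      · rw [abs_of_nonneg h] at h4
        refine ⟨α.im - s, by nlinarith, ?_⟩
        rw [abs_lt]
        constructor <;> nlinarith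
      · rw [abs_of_nonpos h] at h4
        refine ⟨α.im + s, by nlinarith, ?_⟩
        rw [abs_lt]
        constructor <;> nlinarith
    have hz : Complex.I * y / conj β ∈ ball (0 : ℂ) 1 := by
      rw [mem_ball_zero_iff, norm_div, norm_mul, Complex.norm_I, one_mul, Complex.norm_real,
        Complex.norm_conj, Real.norm_eq_abs, div_lt_one hβpos]
      exact hyβ
    refine hfix _ hz ?_
    rw [hf _ hz, div_eq_iff (hden _ hz)]
    have hα : conj α - α = - (2 * α.im) * Complex.I := by
      apply Complex.ext <;> simp
      ring
    have hyc : (y : ℂ) ^ 2 - 2 * α.im * y + β * conj β = 0 := by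
      rw [Complex.mul_conj']
      exact_mod_cast hy
    have hI : Complex.I * Complex.I = -1 := Complex.I_mul_I
    have key : (Complex.I * y / conj β) * (conj α - α) +
        (Complex.I * y / conj β) * (conj β * (Complex.I * y / conj β)) - β = 0 := by
      rw [hα, mul_div_cancel₀ _ hcβ]
      have : (Complex.I * y / conj β) * (-(2 * α.im) * Complex.I) +
        (Complex.I * y / conj β) * (Complex.I * y) - β =
        -((y : ℂ) ^ 2 - 2 * α.im * y + β * conj β) / conj β := by
        rw [eq_div_iff hcβ, sub_mul, add_mul, mul_right_comm, div_mul_cancel₀ _ hcβ,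
          mul_right_comm _ (Complex.I * (y : ℂ)) (conj β), div_mul_cancel₀ _ hcβ]
        linear_combination (-2 * (α.im : ℂ) * y + y ^ 2) * hI
      rw [this, hyc]; simp
    linear_combination -key
  let v : ℕ → ℂ × ℂ := fun n => (fun p : ℂ × ℂ =>
    (α * p.1 + β * p.2, conj β * p.1 + conj α * p.2))^[n] (0, 1)
  have hv0 : v 0 = (0, 1) := rfl
  have hvs : ∀ n, v (n + 1) =
      (α * (v n).1 + β * (v n).2, conj β * (v n).1 + conj α * (v n).2) := fun n =>
    Function.iterate_succ_apply' _ n _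
  have hinv : ∀ n, (v n).2 * conj (v n).2 - (v n).1 * conj (v n).1 = 1 := by
    intro n
    induction n with
    | zero => simp [hv0]
    | succ n ih =>
      rw [hvs]
      simp only [map_add, map_mul, Complex.conj_conj]
      linear_combination (α * conj α - β * conj β) * ih + hd'
  have hinv' : ∀ n, ‖(v n).2‖ ^ 2 - ‖(v n).1‖ ^ 2 = 1 := by
    intro n
    have := hinv n
    rw [Complex.mul_conj', Complex.mul_conj'] at this
    exact_mod_cast this
  have hD : ∀ n, 0 < ‖(v n).2‖ := by
    intro n
    refine (norm_nonneg _).lt_of_ne fun h => ?_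
    have := hinv' n
    rw [← h] at this
    nlinarith [sq_nonneg ‖(v n).1‖]
  have hball : ∀ n, (v n).1 / (v n).2 ∈ ball (0 : ℂ) 1 := by
    intro n
    rw [mem_ball_zero_iff, norm_div, div_lt_one (hD n)]
    nlinarith [hinv' n, norm_nonneg (v n).1, hD n]
  have hit : ∀ n, f^[n] 0 = (v n).1 / (v n).2 := by
    intro n
    induction n with
    | zero => simp [hv0]
    | succ n ih =>
      have h2 : (v n).2 ≠ 0 := norm_pos_iff.mp (hD n)
      rw [Function.iterate_succ_apply', ih, hf _ (hball n), hvs]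
      have e1 : α * ((v n).1 / (v n).2) + β = (α * (v n).1 + β * (v n).2) / (v n).2 := by
        field_simp
      have e2 : conj β * ((v n).1 / (v n).2) + conj α =
          (conj β * (v n).1 + conj α * (v n).2) / (v n).2 := by
        field_simp
      rw [e1, e2, div_div_div_cancel_right₀ h2]
  have hrec : ∀ n, (v (n + 2)).1 = (α + conj α) * (v (n + 1)).1 - (v n).1 := by
    intro n
    rw [hvs (n + 1), hvs n]
    linear_combination -(v n).1 * hd'
  have hgrow : ∀ n, ‖(v n).1‖ + ‖β‖ ≤ ‖(v (n + 1)).1‖ := by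
    intro n
    induction n with
    | zero => simp [hvs, hv0]
    | succ n ih =>
      have h1 : ‖(α + conj α) * (v (n + 1)).1‖ ≤ ‖(v (n + 2)).1‖ + ‖(v n).1‖ := by
        have : (α + conj α) * (v (n + 1)).1 = (v (n + 2)).1 + (v n).1 := by rw [hrec]; ring
        rw [this]
        exact norm_add_le _ _
      rw [norm_mul] at h1
      have : 2 * ‖(v (n + 1)).1‖ ≤ ‖α + conj α‖ * ‖(v (n + 1)).1‖ := by gcongr
      change ‖(v (n + 1)).1‖ + ‖β‖ ≤ ‖(v (n + 2)).1‖
      linarith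
  have hlow : ∀ n : ℕ, n * ‖β‖ ≤ ‖(v n).1‖ := by
    intro n
    induction n with
    | zero => simp [hv0]
    | succ n ih => push_cast; linarith [hgrow n]
  have hlim : Tendsto (fun n : ℕ => ‖(v n).1‖) atTop atTop :=
    tendsto_atTop_mono hlow (tendsto_natCast_atTop_atTop.atTop_mul_const hβpos)
  have hlimD : Tendsto (fun n : ℕ => ‖(v n).2‖) atTop atTop := by
    refine tendsto_atTop_mono (fun n => ?_) hlim
    nlinarith [hinv' n, norm_nonneg (v n).1, hD n]
  have hsq : Tendsto (fun n : ℕ => ‖(v n).1 / (v n).2‖ ^ 2) atTop (𝓝 1) := by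
    have h1 : ∀ n, ‖(v n).1 / (v n).2‖ ^ 2 = 1 - (‖(v n).2‖⁻¹) ^ 2 := by
      intro n
      have h0 := (hD n).ne'
      have := hinv' n
      rw [norm_div, div_pow, inv_pow, eq_sub_iff_add_eq, div_add' _ _ _ (by positivity),
        inv_mul_cancel₀ (by positivity), div_eq_one_iff_eq (by positivity)]
      linarith
    simp_rw [h1]
    simpa using (tendsto_inv_atTop_zero.comp hlimD).pow 2 |>.const_sub 1
  have := (Real.continuous_sqrt.tendsto _).comp hsq
  simp only [Real.sqrt_one] at this
  refine this.congr fun n => ?_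
  simp only [Function.comp_apply]
  rw [Real.sqrt_sq (norm_nonneg _), hit]

section SchwarzPick

variable {f : ℂ → ℂ} {a z : ℂ}

theorem differentiableOn_mob_comp_mob (hf : DifferentiableOn ℂ f (ball 0 1))
    (hm : MapsTo f (ball 0 1) (ball 0 1)) (ha : a ∈ ball (0 : ℂ) 1) :
    DifferentiableOn ℂ (fun u => mob (f a) (f (mob (-a) u))) (ball 0 1) ∧
      MapsTo (fun u => mob (f a) (f (mob (-a) u))) (ball 0 1) (ball 0 1) := by
  have h1 : ‖-a‖ < 1 := by simpa using ha
  have h2 : ‖f a‖ < 1 := mem_ball_zero_iff.mp (hm ha)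
  exact ⟨(mob_differentiableOn h2).comp (hf.comp (mob_differentiableOn h1) (mob_mapsTo h1))
    (hm.comp (mob_mapsTo h1)), (mob_mapsTo h2).comp (hm.comp (mob_mapsTo h1))⟩

/-- The **Schwarz–Pick lemma**. -/
theorem norm_mob_map_le (hf : DifferentiableOn ℂ f (ball 0 1))
    (hm : MapsTo f (ball 0 1) (ball 0 1)) (ha : a ∈ ball (0 : ℂ) 1) (hz : z ∈ ball (0 : ℂ) 1) :
    ‖mob (f a) (f z)‖ ≤ ‖mob a z‖ := by
  obtain ⟨h1, h2⟩ := differentiableOn_mob_comp_mob hf hm ha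
  rw [mem_ball_zero_iff] at ha hz
  have := Complex.norm_le_norm_of_mapsTo_ball h1 (h2.mono_right ball_subset_closedBall)
    (by simp [mob_neg_zero, mob_self]) (norm_mob_lt_one ha hz)
  simpa [mob_neg_mob ha hz] using this

/-- The equality case of the Schwarz–Pick lemma. -/
theorem exists_mob_map_eq_of_norm_mob_map_eq (hf : DifferentiableOn ℂ f (ball 0 1))
    (hm : MapsTo f (ball 0 1) (ball 0 1)) (ha : a ∈ ball (0 : ℂ) 1) (hz : z ∈ ball (0 : ℂ) 1)
    (haz : a ≠ z) (h : ‖mob (f a) (f z)‖ = ‖mob a z‖) :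
    ∃ ω : ℂ, ‖ω‖ = 1 ∧ ∀ x ∈ ball (0 : ℂ) 1, mob (f a) (f x) = ω * mob a x := by
  obtain ⟨h1, h2⟩ := differentiableOn_mob_comp_mob hf hm ha
  rw [mem_ball_zero_iff] at ha hz
  set F := fun u => mob (f a) (f (mob (-a) u)) with hF
  have hF0 : F 0 = 0 := by simp [hF, mob_neg_zero, mob_self]
  have hFm : ∀ x ∈ ball (0 : ℂ) 1, F (mob a x) = mob (f a) (f x) := by
    intro x hx
    rw [mem_ball_zero_iff] at hx
    simp [hF, mob_neg_mob ha hx]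
  have hne : mob a z ≠ 0 := by
    intro h0
    rw [← mob_self a] at h0
    exact haz (mob_injOn ha (by simpa using hz) (by simpa using ha) h0).symm
  have hds : ‖dslope F 0 (mob a z)‖ = 1 := by
    rw [dslope_of_ne _ hne, slope_def_field, hF0, sub_zero, sub_zero, norm_div,
      hFm z (by simpa using hz), h, div_self (norm_ne_zero_iff.mpr hne)]
  refine ⟨dslope F 0 (mob a z), hds, fun x hx => ?_⟩
  have := Complex.affine_of_mapsTo_ball_of_norm_dslope_eq_div (R₂ := 1) h1
    (by rw [hF0]; exact h2.mono_right ball_subset_closedBall)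
    (mem_ball_zero_iff.mpr (norm_mob_lt_one ha hz)) (by rw [hds, div_one])
    (mob_mapsTo ha hx)
  rw [← hFm x hx, this]
  simp [hF0, mul_comm]

end SchwarzPick

theorem exists_linear_fractional {f : ℂ → ℂ} (hm : MapsTo f (ball 0 1) (ball 0 1)) {a ω : ℂ}
    (ha : a ∈ ball (0 : ℂ) 1) (hω : ‖ω‖ = 1)
    (h : ∀ x ∈ ball (0 : ℂ) 1, mob (f a) (f x) = ω * mob a x) :
    ∃ α β : ℂ, ‖α‖ ^ 2 - ‖β‖ ^ 2 = 1 ∧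
      ∀ z ∈ ball (0 : ℂ) 1, f z = (α * z + β) / (conj β * z + conj α) := by
  set b := f a with hb
  have hb1 : ‖b‖ < 1 := mem_ball_zero_iff.mp (hm ha)
  rw [mem_ball_zero_iff] at ha
  obtain ⟨η, hη⟩ : ∃ η : ℂ, η ^ 2 * ω = 1 := by
    obtain ⟨η, hη⟩ := IsAlgClosed.exists_pow_nat_eq (ω⁻¹) (n := 2) (by norm_num)
    exact ⟨η, by rw [hη, inv_mul_cancel₀ (norm_ne_zero_iff.mp (by rw [hω]; norm_num))]⟩
  have hηn : ‖η‖ = 1 := by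
    have : ‖η‖ ^ 2 = 1 := by simpa [hω] using congrArg norm hη
    nlinarith [norm_nonneg η]
  have hηc : η * conj η = 1 := by rw [Complex.mul_conj', hηn]; simp
  have hωc : ω * conj ω = 1 := by rw [Complex.mul_conj', hω]; simp
  have hη0 : η ≠ 0 := left_ne_zero_of_mul (hηc.trans_ne one_ne_zero)
  set r : ℝ := √((1 - ‖a‖ ^ 2) * (1 - ‖b‖ ^ 2)) with hr
  have hpos : 0 < (1 - ‖a‖ ^ 2) * (1 - ‖b‖ ^ 2) := by
    apply mul_pos <;> nlinarith [norm_nonneg a, norm_nonneg b]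
  have hr0 : 0 < r := Real.sqrt_pos.mpr hpos
  have hr2 : r ^ 2 = (1 - ‖a‖ ^ 2) * (1 - ‖b‖ ^ 2) := Real.sq_sqrt hpos.le
  have hrc : (r : ℂ) ≠ 0 := by exact_mod_cast hr0.ne'
  have hcη : conj η = η * ω := by
    apply mul_left_cancel₀ hη0
    rw [hηc, ← hη]; ring
  have hcω : conj ω = η ^ 2 := by
    apply mul_left_cancel₀ (left_ne_zero_of_mul (hωc.trans_ne one_ne_zero))
    rw [hωc, ← hη]; ring
  refine ⟨η * (ω - b * conj a) / r, η * (b - ω * a) / r, ?_, ?_⟩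
  · have h1 : (((‖η * (ω - b * conj a) / r‖ ^ 2 - ‖η * (b - ω * a) / r‖ ^ 2 : ℝ)) : ℂ) =
        ((1 - a * conj a) * (1 - b * conj b)) / (r : ℂ) ^ 2 := by
      push_cast
      rw [← Complex.mul_conj', ← Complex.mul_conj']
      simp only [map_div₀, map_mul, map_sub, Complex.conj_conj, Complex.conj_ofReal]
      rw [eq_div_iff (pow_ne_zero 2 hrc)]
      field_simp
      linear_combination (1 - a * conj a) * (1 - b * conj b) * hηc +
        η * conj η * (1 - a * conj a) * hωc
    have h2 : ((r : ℂ)) ^ 2 = (1 - a * conj a) * (1 - b * conj b) := by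
      rw [Complex.mul_conj', Complex.mul_conj']
      exact_mod_cast hr2
    rw [← h2, div_self (pow_ne_zero 2 hrc)] at h1
    exact_mod_cast h1
  · intro z hz
    have hfz := hm hz
    have hz' := hz
    rw [mem_ball_zero_iff] at hz hfz
    have hd := mob_den_ne_zero ha hz
    have e := h z hz'
    have hmz : ‖ω * mob a z‖ < 1 := by
      rw [norm_mul, hω, one_mul]; exact norm_mob_lt_one ha hz
    have hd2 := mob_den_ne_zero (c := -b) (by simpa using hb1) hmz
    have e2 : f z = mob (-b) (ω * mob a z) := by rw [← e, mob_neg_mob hb1 hfz]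
    have e3 : mob (-b) (ω * mob a z) =
        (ω * (z - a) + b * (1 - conj a * z)) / ((1 - conj a * z) + conj b * ω * (z - a)) := by
      have e4 : ω * mob a z - -b = (ω * (z - a) + b * (1 - conj a * z)) / (1 - conj a * z) := by
        rw [mob, eq_div_iff hd, sub_mul, mul_assoc, div_mul_cancel₀ _ hd]; ring
      have e5 : 1 - conj (-b) * (ω * mob a z) =
          ((1 - conj a * z) + conj b * ω * (z - a)) / (1 - conj a * z) := by
        rw [mob, eq_div_iff hd, sub_mul, mul_assoc, mul_assoc, div_mul_cancel₀ _ hd, map_neg]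
        ring
      rw [mob, e4, e5, div_div_div_cancel_right₀ hd]
    have e6 : η * (ω - b * conj a) / r * z + η * (b - ω * a) / r =
        (η / r) * (ω * (z - a) + b * (1 - conj a * z)) := by ring
    have e7 : conj (η * (b - ω * a) / r) * z + conj (η * (ω - b * conj a) / r) =
        (η / r) * ((1 - conj a * z) + conj b * ω * (z - a)) := by
      simp only [map_div₀, map_mul, map_sub, Complex.conj_conj, Complex.conj_ofReal, hcη, hcω]
      linear_combination (η / r * (1 - conj a * z)) * hη
    rw [e2, e3, e6, e7, mul_div_mul_left _ _ (div_ne_zero hη0 hrc)]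

theorem continuousOn_norm_mob : ContinuousOn (fun p : ℂ × ℂ => ‖mob p.1 p.2‖)
    (ball 0 1 ×ˢ ball 0 1) := by
  refine ContinuousOn.norm (ContinuousOn.div (by fun_prop) ?_ ?_)
  · exact (continuous_const.sub
      ((Complex.continuous_conj.comp continuous_fst).mul continuous_snd)).continuousOn
  · rintro ⟨c, z⟩ ⟨hc, hz⟩
    exact mob_den_ne_zero (mem_ball_zero_iff.mp hc) (mem_ball_zero_iff.mp hz)

/-- Orbits of a fixed point free holomorphic self-map of the disc escape to the boundary. -/
theorem tendsto_norm_iterate_of_forall_ne {f : ℂ → ℂ} (hf : DifferentiableOn ℂ f (ball 0 1))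
    (hm : MapsTo f (ball 0 1) (ball 0 1)) (hfix : ∀ z ∈ ball (0 : ℂ) 1, f z ≠ z) :
    Tendsto (fun n => ‖f^[n] 0‖) atTop (𝓝 1) := by
  have hmn : ∀ n, f^[n] 0 ∈ ball (0 : ℂ) 1 := fun n => hm.iterate n (by simp)
  by_contra hcon
  obtain ⟨ρ, hρ, hfr⟩ : ∃ ρ < 1, ∃ᶠ n in atTop, f^[n] 0 ∈ closedBall (0 : ℂ) ρ := by
    rw [tendsto_order] at hcon
    by_contra! h
    refine hcon ⟨fun ρ hρ => ?_, fun ρ hρ => .of_forall fun n => ?_⟩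
    · have := h ρ hρ
      simpa using this
    · exact (mem_ball_zero_iff.mp (hmn n)).trans hρ
  obtain ⟨c, hc, φ, hφ, hlim⟩ := (isCompact_closedBall (0 : ℂ) ρ).tendsto_subseq' hfr
  have hcb : c ∈ ball (0 : ℂ) 1 := closedBall_subset_ball hρ hc
  have hfc := hm hcb
  have hcont : ∀ x ∈ ball (0 : ℂ) 1, ContinuousAt f x := fun x hx =>
    (hf.differentiableAt (isOpen_ball.mem_nhds hx)).continuousAt
  have hDc : ∀ x ∈ ball (0 : ℂ) 1, ContinuousAt (fun x => ‖mob x (f x)‖) x := by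
    intro x hx
    have h1 : ContinuousAt (fun p : ℂ × ℂ => ‖mob p.1 p.2‖) (x, f x) :=
      continuousOn_norm_mob.continuousAt ((isOpen_ball.prod isOpen_ball).mem_nhds ⟨hx, hm hx⟩)
    exact ContinuousAt.comp (f := fun x => (x, f x)) h1 (continuousAt_id.prodMk (hcont x hx))
  set d : ℕ → ℝ := fun n => ‖mob (f^[n] 0) (f (f^[n] 0))‖ with hd
  have hanti : Antitone d := antitone_nat_of_succ_le fun n => by
    simp only [hd, Function.iterate_succ_apply']
    exact norm_mob_map_le hf hm (hmn n) (hm (hmn n))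
  obtain ⟨l, hl⟩ : ∃ l, Tendsto d atTop (𝓝 l) :=
    ⟨_, tendsto_atTop_ciInf hanti ⟨0, by rintro _ ⟨n, rfl⟩; exact norm_nonneg _⟩⟩
  have h1 : ‖mob c (f c)‖ = l :=
    tendsto_nhds_unique ((hDc c hcb).tendsto.comp hlim) (hl.comp hφ.tendsto_atTop)
  have h2 : ‖mob (f c) (f (f c))‖ = l := by
    refine tendsto_nhds_unique ((hDc (f c) hfc).tendsto.comp ((hcont c hcb).tendsto.comp hlim))
      ((hl.comp ((tendsto_add_atTop_nat 1).comp hφ.tendsto_atTop)).congr fun n => ?_)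
    simp [hd, Function.iterate_succ_apply']
  obtain ⟨ω, hω, hmob⟩ := exists_mob_map_eq_of_norm_mob_map_eq hf hm hcb hfc (hfix c hcb).symm
    (h2.trans h1.symm)
  obtain ⟨α, β, hαβ, hff⟩ := exists_linear_fractional hm hcb hω hmob
  exact hcon (tendsto_norm_iterate_of_linear_fractional hαβ hff hfix)

theorem norm_sub_le_of_norm_mob_le {c w : ℂ} {ρ : ℝ} (hc : ‖c‖ < 1) (hw : ‖w‖ < 1) (hρ : ρ < 1)
    (h : ‖mob c w‖ ≤ ρ) : ‖w - c‖ ≤ 2 / (1 - ρ) * (1 - ‖c‖) := by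
  have hd := mob_den_ne_zero hc hw
  have hρ0 : 0 ≤ ρ := (norm_nonneg _).trans h
  have h1 : w - c = mob c w * ((1 - ‖c‖ ^ 2 : ℝ) - conj c * (w - c)) := by
    have : ((1 - ‖c‖ ^ 2 : ℝ) : ℂ) - conj c * (w - c) = 1 - conj c * w := by
      push_cast
      rw [← Complex.mul_conj']
      ring
    rw [this, mob, div_mul_cancel₀ _ hd]
  have h2 : ‖w - c‖ ≤ ρ * ((1 - ‖c‖ ^ 2) + ‖w - c‖) := by
    conv_lhs => rw [h1]
    rw [norm_mul]
    gcongr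
    refine (norm_sub_le _ _).trans ?_
    rw [Complex.norm_real, Real.norm_of_nonneg (by nlinarith [norm_nonneg c]), norm_mul,
      Complex.norm_conj]
    gcongr
    exact mul_le_of_le_one_left (norm_nonneg _) hc.le
  rw [div_mul_eq_mul_div, le_div_iff₀ (by linarith)]
  nlinarith [norm_nonneg c, mul_nonneg (sub_nonneg.mpr hρ.le) (sub_nonneg.mpr hc.le)]

/-- High iterates of a fixed point free holomorphic self-map of the disc can be separated from the
identity on a compact set by a holomorphic function. -/
theorem exists_separating_ball {f : ℂ → ℂ} (hf : DifferentiableOn ℂ f (ball 0 1))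
    (hm : MapsTo f (ball 0 1) (ball 0 1)) (hfix : ∀ z ∈ ball (0 : ℂ) 1, f z ≠ z) {K : Set ℂ}
    (hK : IsCompact K) (hKb : K ⊆ ball 0 1) :
    ∃ M : ℕ, ∀ m, M ≤ m → ∃ q : ℂ → ℂ, DifferentiableOn ℂ q (ball 0 1) ∧
      (∀ z ∈ K, ‖q z‖ ≤ 1 / 10) ∧ ∀ z ∈ K, ‖q (f^[m] z) - 1‖ ≤ 1 / 10 := by
  obtain ⟨ρ, hρ0, hρ1, hKρ⟩ : ∃ ρ : ℝ, 0 ≤ ρ ∧ ρ < 1 ∧ ∀ z ∈ K, ‖z‖ ≤ ρ := by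
    rcases K.eq_empty_or_nonempty with rfl | hne
    · exact ⟨0, le_rfl, one_pos, by simp⟩
    · obtain ⟨x, hx, hmax⟩ := hK.exists_isMaxOn hne continuous_norm.continuousOn
      exact ⟨‖x‖, norm_nonneg x, by simpa using hKb hx, fun z hz => hmax hz⟩
  obtain ⟨a, ha⟩ := exists_pow_lt_of_lt_one (show (0 : ℝ) < 1 / 10 by norm_num)
    (show (1 + ρ) / 2 < 1 by linarith)
  obtain ⟨δ, hδ, hpow⟩ : ∃ δ > 0, ∀ x : ℂ, ‖x - 1‖ < δ → ‖x ^ a - 1‖ < 1 / 10 := by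
    have := Metric.continuous_iff.mp (continuous_pow (M := ℂ) a) 1 (1 / 10) (by norm_num)
    simpa [dist_eq_norm] using this
  have hlim := tendsto_norm_iterate_of_forall_ne hf hm hfix
  have hsmall : Tendsto (fun n => (1 - ‖f^[n] 0‖) * (2 / (1 - ρ) + 1)) atTop (𝓝 0) := by
    simpa using (hlim.const_sub 1).mul_const (2 / (1 - ρ) + 1)
  obtain ⟨M, hM⟩ := eventually_atTop.mp
    ((hsmall.eventually_lt_const hδ).and (hlim.eventually_const_lt one_pos))
  refine ⟨M, fun m hmM => ?_⟩
  obtain ⟨h1, h2⟩ := hM m hmM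
  set c := f^[m] 0 with hc
  have hcb : ‖c‖ < 1 := mem_ball_zero_iff.mp (hm.iterate m (by simp))
  have hc0 : c ≠ 0 := norm_pos_iff.mp h2
  set p : ℂ := c / ‖c‖ with hp
  have hpn : ‖p‖ = 1 := by simp [hp, hc0]
  have hpc : conj p * c = ‖c‖ := by
    have : (‖c‖ : ℂ) ≠ 0 := by exact_mod_cast h2.ne'
    rw [hp, map_div₀, Complex.conj_ofReal, div_mul_eq_mul_div, mul_comm, Complex.mul_conj',
      sq, mul_div_assoc, div_self this, mul_one]
  refine ⟨fun z => ((1 + conj p * z) / 2) ^ a, by fun_prop, fun z hz => ?_, fun z hz => ?_⟩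
  · rw [norm_pow]
    refine le_trans ?_ ha.le
    gcongr
    rw [norm_div, Complex.norm_ofNat]
    gcongr
    refine (norm_add_le _ _).trans ?_
    rw [norm_one, norm_mul, Complex.norm_conj, hpn, one_mul]
    gcongr
    exact hKρ z hz
  · refine (hpow _ ?_).le
    have hz1 : ‖z‖ < 1 := mem_ball_zero_iff.mp (hKb hz)
    have hw : ‖f^[m] z‖ < 1 := mem_ball_zero_iff.mp (hm.iterate m (hKb hz))
    have h3 : ‖mob c (f^[m] z)‖ ≤ ρ := by
      refine (norm_mob_map_le (hf.iterate hm m) (hm.iterate m) (by simp) (hKb hz)).trans ?_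
      simpa [mob] using hKρ z hz
    have h4 := norm_sub_le_of_norm_mob_le hcb hw hρ1 h3
    have h5 : (1 + conj p * f^[m] z) / 2 - 1 =
        (conj p * (f^[m] z - c) - ((1 - ‖c‖ : ℝ) : ℂ)) / 2 := by
      rw [mul_sub, hpc]; push_cast; ring
    rw [h5, norm_div, Complex.norm_ofNat]
    have h6 := norm_sub_le (conj p * (f^[m] z - c)) ((1 - ‖c‖ : ℝ) : ℂ)
    rw [norm_mul, Complex.norm_conj, hpn, one_mul, Complex.norm_real,
      Real.norm_of_nonneg (by linarith)] at h6
    have h7 : 0 ≤ ‖conj p * (f^[m] z - c) - ((1 - ‖c‖ : ℝ) : ℂ)‖ := norm_nonneg _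
    linarith

theorem isPreconnected_annulus (r R : ℝ) (hr : 0 ≤ r) :
    IsPreconnected (ball (0 : ℂ) R \ closedBall 0 r) := by
  have h : ball (0 : ℂ) R \ closedBall 0 r =
      (fun p : ℝ × ℝ => (p.1 : ℂ) * Complex.exp (p.2 * Complex.I)) '' (Ioo r R ×ˢ univ) := by
    ext z
    simp only [Set.mem_sdiff, mem_ball_zero_iff, mem_closedBall_zero_iff, not_le, mem_image, mem_prod,
      mem_Ioo, mem_univ, and_true, Prod.exists]
    constructor
    · rintro ⟨h1, h2⟩
      exact ⟨‖z‖, z.arg, ⟨h2, h1⟩, Complex.norm_mul_exp_arg_mul_I z⟩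
    · rintro ⟨a, b, ⟨h1, h2⟩, rfl⟩
      rw [norm_mul, Complex.norm_exp_ofReal_mul_I, mul_one, Complex.norm_real,
        Real.norm_of_nonneg (hr.trans h1.le)]
      exact ⟨h2, h1⟩
  rw [h]
  exact (isPreconnected_Ioo.prod isPreconnected_univ).image _ (by fun_prop)

/-- A compact plane set whose boundary lies in a compact subset `L` of an open set `Ω` with
`Ω \ L` connected does not meet `Ω \ L`. -/
theorem disjoint_sdiff_of_frontier_subset {S L Ω : Set ℂ} (hS : IsCompact S) (hL : IsCompact L)
    (hΩ : IsOpen Ω) (hLΩ : L ⊆ Ω) (hc : IsPreconnected (Ω \ L)) (hf : frontier S ⊆ L) :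
    Disjoint (Ω \ L) S := by
  rw [disjoint_iff_inter_eq_empty]
  by_contra hne
  have hne' : ((Ω \ L) ∩ S).Nonempty := nonempty_iff_ne_empty.mpr hne
  have hsub : Ω \ L ⊆ S := by
    by_contra hn
    obtain ⟨x, hx, hxS⟩ := not_subset.mp hn
    have hin : ∀ v ∈ Ω \ L, v ∈ S → v ∈ interior S := fun v hv hvS => by
      by_contra h
      exact hv.2 (hf ⟨subset_closure hvS, h⟩)
    have hcov : Ω \ L ⊆ interior S ∪ Sᶜ := fun v hv => by
      by_cases h : v ∈ S
      exacts [.inl (hin v hv h), .inr h]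
    obtain ⟨v, -, hv1, hv2⟩ := hc _ _ isOpen_interior hS.isClosed.isOpen_compl hcov
      (hne'.imp fun v hv => ⟨hv.1, hin v hv.1 hv.2⟩) ⟨x, hx, hxS⟩
    exact hv2 (interior_subset hv1)
  have hopen : IsOpen (S ∪ L) := by
    rw [isOpen_iff_mem_nhds]
    have hΩs : Ω ⊆ S ∪ L := fun x hx => by
      by_cases h : x ∈ L
      · exact .inr h
      · exact .inl (hsub ⟨hx, h⟩)
    intro x hx
    by_cases h : x ∈ L
    · exact mem_of_superset (hΩ.mem_nhds (hLΩ h)) hΩs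
    · have hxS : x ∈ S := hx.resolve_right h
      have : x ∈ interior S := by
        by_contra hi
        exact h (hf ⟨subset_closure hxS, hi⟩)
      exact mem_of_superset (mem_interior_iff_mem_nhds.mp this) subset_union_left
  have hcpt := hS.union hL
  rcases isClopen_iff.mp ⟨hcpt.isClosed, hopen⟩ with h | h
  · obtain ⟨x, hx⟩ := hne'
    have : x ∈ S ∪ L := .inl hx.2
    rw [h] at this
    exact this
  · exact noncompact_univ ℂ (h ▸ hcpt)

/-- Cauchy's formula in the coordinate given by an injective holomorphic function. -/
theorem circleIntegral_div_sub_of_injOn {φ G : ℂ → ℂ} (hφ : DifferentiableOn ℂ φ (ball 0 1))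
    (hi : InjOn φ (ball 0 1)) (hG : DifferentiableOn ℂ G (ball 0 1)) {r : ℝ} (hr : r < 1) {z : ℂ}
    (hz : z ∈ ball (0 : ℂ) r) :
    (∮ u in C(0, r), (G u * deriv φ u) * (φ u - φ z)⁻¹) = (2 * Real.pi * Complex.I) * G z := by
  have hz1 : z ∈ ball (0 : ℂ) 1 := ball_subset_ball hr.le hz
  have hr0 : 0 < r := pos_of_mem_ball hz
  have hcb : closedBall (0 : ℂ) r ⊆ ball 0 1 := closedBall_subset_ball hr
  have hds : DifferentiableOn ℂ (dslope φ z) (ball 0 1) :=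
    (Complex.differentiableOn_dslope (isOpen_ball.mem_nhds hz1)).mpr hφ
  have hne : ∀ u ∈ ball (0 : ℂ) 1, dslope φ z u ≠ 0 := by
    intro u hu
    rcases eq_or_ne u z with rfl | h
    · rw [dslope_same]
      exact deriv_ne_zero_of_injOn isOpen_ball hφ hi hu
    · rw [dslope_of_ne _ h, slope_def_field]
      exact div_ne_zero (sub_ne_zero.mpr fun e => h (hi hu hz1 e)) (sub_ne_zero.mpr h)
  have hH : DifferentiableOn ℂ (fun u => G u * deriv φ u / dslope φ z u) (ball 0 1) :=
    (hG.mul (hφ.deriv isOpen_ball)).div hds hne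
  have := (hH.mono hcb).circleIntegral_sub_inv_smul hz
  simp only [smul_eq_mul, dslope_same] at this
  rw [mul_div_cancel_right₀ _ (deriv_ne_zero_of_injOn isOpen_ball hφ hi hz1)] at this
  rw [← this]
  refine circleIntegral.integral_congr hr0.le fun u hu => ?_
  have huz : u ≠ z := by
    rintro rfl
    rw [mem_sphere] at hu
    rw [mem_ball, hu] at hz
    exact lt_irrefl _ hz
  have h1 : u - z ≠ 0 := sub_ne_zero.mpr huz
  rw [dslope_of_ne _ huz, slope_def_field, div_div_eq_mul_div, mul_comm (u - z)⁻¹, ← div_eq_mul_inv,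
    ← div_eq_mul_inv, div_right_comm, mul_div_cancel_right₀ _ h1]

/-- Polynomials in an injective holomorphic function on the disc are dense in the holomorphic
functions. -/
theorem exists_polynomial_near_ball {φ G : ℂ → ℂ} (hφ : DifferentiableOn ℂ φ (ball 0 1))
    (hi : InjOn φ (ball 0 1)) (hG : DifferentiableOn ℂ G (ball 0 1)) {K : Set ℂ}
    (hK : IsCompact K) (hKb : K ⊆ ball 0 1) {ε : ℝ} (hε : 0 < ε) :
    ∃ Q : Polynomial ℂ, ∀ z ∈ K, ‖Q.eval (φ z) - G z‖ < ε := by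
  obtain ⟨s, hs0, hs1, hKs⟩ : ∃ s : ℝ, 0 < s ∧ s < 1 ∧ K ⊆ closedBall 0 s := by
    obtain ⟨s, hs, hKs⟩ := exists_lt_subset_ball hK.isClosed hKb
    refine ⟨max s (1 / 2), by positivity, max_lt hs (by norm_num), hKs.trans
      (ball_subset_closedBall.trans (closedBall_subset_closedBall (le_max_left _ _)))⟩
  obtain ⟨r, hsr, hr1⟩ := exists_between hs1
  have hr0 : 0 < r := hs0.trans hsr
  set D := closedBall (0 : ℂ) s with hD
  have hDb : D ⊆ ball 0 1 := closedBall_subset_ball hs1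
  have : CompactSpace D := isCompact_iff_compactSpace.mp (isCompact_closedBall 0 s)
  set p : C(D, ℂ) := ⟨D.domRestrict φ, (hφ.continuousOn.mono hDb).domRestrict⟩ with hp
  set A := Algebra.elemental ℂ p
  set a : A := ⟨p, Algebra.elemental.self_mem ℂ p⟩ with ha
  have hfr : frontier (spectrum ℂ a) ⊆ φ '' D := by
    have h1 : IsClosed (A : Set C(D, ℂ)) := Algebra.elemental.isClosed ℂ p
    have h2 := Subalgebra.frontier_spectrum A a
    rw [ha, ContinuousMap.spectrum_eq_range] at h2
    rintro x hx
    obtain ⟨z, rfl⟩ := h2 hx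
    exact ⟨z, z.2, rfl⟩
  have hLΩ : φ '' D ⊆ φ '' ball 0 1 := image_mono hDb
  have hann : φ '' ball 0 1 \ φ '' D = φ '' (ball 0 1 \ D) := by
    rw [hi.image_sdiff, inter_eq_right.mpr hDb]
  have hdisj := disjoint_sdiff_of_frontier_subset (spectrum.isCompact (𝕜 := ℂ) a)
    ((isCompact_closedBall 0 s).image_of_continuousOn (hφ.continuousOn.mono hDb))
    (isOpen_image_of_injOn isOpen_ball hφ hi) hLΩ
    (hann ▸ (isPreconnected_annulus s 1 hs0.le).image _ (hφ.continuousOn.mono sdiff_subset)) hfr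
  have hunit : ∀ u ∈ sphere (0 : ℂ) r, IsUnit (algebraMap ℂ A (φ u) - a) := by
    intro u hu
    have hu' : u ∈ ball (0 : ℂ) 1 \ D := by
      rw [mem_sphere_zero_iff_norm] at hu
      simp [hD, hu, hsr, hr1]
    have := disjoint_left.mp hdisj (hann ▸ mem_image_of_mem φ hu')
    rwa [spectrum.notMem_iff] at this
  have hsph : sphere (0 : ℂ) r ⊆ ball 0 1 := sphere_subset_closedBall.trans
    (closedBall_subset_ball hr1)
  set I : ℂ → A := fun u => (G u * deriv φ u) • Ring.inverse (algebraMap ℂ A (φ u) - a) with hI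
  have hIc : ContinuousOn I (sphere 0 r) := by
    refine ContinuousOn.smul ((hG.continuousOn.mul (hφ.deriv isOpen_ball).continuousOn).mono hsph) ?_
    intro u hu
    obtain ⟨v, hv⟩ := hunit u hu
    have h1 : ContinuousWithinAt (fun u => algebraMap ℂ A (φ u) - a) (sphere 0 r) u :=
      (((algebraMapCLM ℂ A).continuous.continuousAt).comp_continuousWithinAt
        ((hφ.continuousOn.mono hsph) u hu)).sub continuousWithinAt_const
    have h2 := NormedRing.inverse_continuousAt v
    rw [hv] at h2
    exact ContinuousAt.comp_continuousWithinAt (g := Ring.inverse)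
      (f := fun u => algebraMap ℂ A (φ u) - a) h2 h1
  have hIi : CircleIntegrable I 0 r := hIc.circleIntegrable hr0.le
  set J : A := ∮ u in C(0, r), I u with hJ
  have hJz : ∀ z : D, (J : C(D, ℂ)) z = (2 * Real.pi * Complex.I) * G z := by
    intro z
    let e : A →L[ℂ] ℂ := (ContinuousMap.evalCLM ℂ z).comp A.toSubmodule.subtypeL
    have he : ∀ b : A, e b = (b : C(D, ℂ)) z := fun b => rfl
    rw [← he, hJ, ← circleIntegral_div_sub_of_injOn hφ hi hG hr1
      (closedBall_subset_ball hsr z.2 : (z : ℂ) ∈ ball 0 r)]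
    rw [circleIntegral, circleIntegral, ← e.intervalIntegral_comp_comm hIi.out]
    refine intervalIntegral.integral_congr fun θ _ => ?_
    have hu := circleMap_mem_sphere 0 hr0.le θ
    simp only [map_smul]
    congr 1
    set u := circleMap 0 r θ
    simp only [hI, map_smul, smul_eq_mul]
    congr 1
    refine eq_inv_of_mul_eq_one_left ?_
    have h3 := Ring.inverse_mul_cancel _ (hunit u hu)
    have h4 := congrArg (fun b : A => (b : C(D, ℂ)) z) h3
    have h8 : p z = φ z := rfl
    simpa [he, ha, h8] using h4
  have hpi : (2 * Real.pi * Complex.I : ℂ) ≠ 0 := Complex.two_pi_I_ne_zero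
  have hmem : ((((2 * Real.pi * Complex.I)⁻¹ : ℂ) • J : A) : C(D, ℂ)) ∈
      closure (Algebra.adjoin ℂ {p} : Set C(D, ℂ)) := Subtype.coe_prop _
  obtain ⟨b, hb, hbd⟩ := Metric.mem_closure_iff.mp hmem ε hε
  rw [SetLike.mem_coe, Algebra.adjoin_singleton_eq_range_aeval] at hb
  obtain ⟨Q, rfl⟩ := hb
  refine ⟨Q, fun z hz => ?_⟩
  have h5 := (ContinuousMap.dist_apply_le_dist (⟨z, hKs hz⟩ : D)).trans_lt hbd
  rw [dist_comm, dist_eq_norm] at h5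
  have h6 : (((((2 * Real.pi * Complex.I)⁻¹ : ℂ) • J : A) : C(D, ℂ))) ⟨z, hKs hz⟩ = G z := by
    change (2 * Real.pi * Complex.I)⁻¹ * (J : C(D, ℂ)) ⟨z, hKs hz⟩ = G z
    rw [hJz, inv_mul_cancel_left₀ hpi]
  have h7 : (Polynomial.aeval p Q : C(D, ℂ)) ⟨z, hKs hz⟩ = Q.eval (φ z) := by
    have : (Polynomial.aeval p Q : C(D, ℂ)) ⟨z, hKs hz⟩ =
        Polynomial.aeval (p ⟨z, hKs hz⟩) Q := by
      have := Polynomial.aeval_algHom_apply (ContinuousMap.evalAlgHom ℂ ℂ (⟨z, hKs hz⟩ : D)) p Q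
      exact this.symm
    rw [this, Polynomial.coe_aeval_eq_eval]
    rfl
  rw [h6] at h5
  rw [← h7]
  exact h5

theorem eq_add_mul_of_norm_le {g : ℂ → ℂ} (hg : Differentiable ℂ g) {A B : ℝ}
    (h : ∀ z, 1 ≤ ‖z‖ → ‖g z‖ ≤ A + B * ‖z‖) : ∃ c, ∀ z, g z = g 0 + c * z := by
  have hd : Differentiable ℂ (dslope g 0) := by
    rw [← differentiableOn_univ, Complex.differentiableOn_dslope univ_mem, differentiableOn_univ]
    exact hg
  have hb : Bornology.IsBounded (range (dslope g 0)) := by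
    obtain ⟨C, hC⟩ := (isCompact_closedBall (0 : ℂ) 1).exists_bound_of_continuousOn
      hd.continuous.continuousOn
    rw [isBounded_iff_forall_norm_le]
    refine ⟨max C (|A| + B + ‖g 0‖), ?_⟩
    rintro _ ⟨z, rfl⟩
    rcases le_total ‖z‖ 1 with hz | hz
    · exact (hC z (by simpa using hz)).trans (le_max_left _ _)
    · refine le_trans ?_ (le_max_right _ _)
      have hz0 : z ≠ 0 := by rintro rfl; norm_num at hz
      rw [dslope_of_ne _ hz0, slope_def_field, sub_zero, norm_div, div_le_iff₀ (by linarith)]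
      have h1 := norm_sub_le (g z) (g 0)
      have h2 := h z hz
      nlinarith [le_abs_self A, abs_nonneg A, norm_nonneg (g 0)]
  refine ⟨dslope g 0 0, fun z => ?_⟩
  have h1 := sub_smul_dslope g 0 z
  rw [hd.apply_eq_apply_of_bounded hb z 0, sub_zero, smul_eq_mul] at h1
  rw [mul_comm, h1]
  ring

/-- An injective entire function is affine. -/
theorem exists_eq_add_mul_of_injective {f : ℂ → ℂ} (hf : Differentiable ℂ f)
    (hi : Function.Injective f) : ∃ c, c ≠ 0 ∧ ∀ z, f z = f 0 + c * z := by
  have hd : Differentiable ℂ (dslope f 0) := by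
    rw [← differentiableOn_univ, Complex.differentiableOn_dslope univ_mem, differentiableOn_univ]
    exact hf
  have hne : ∀ z, dslope f 0 z ≠ 0 := by
    intro z
    rcases eq_or_ne z 0 with rfl | hz
    · rw [dslope_same]
      exact deriv_ne_zero_of_injOn isOpen_univ hf.differentiableOn hi.injOn (mem_univ _)
    · rw [dslope_of_ne _ hz, slope_def_field, sub_zero]
      exact div_ne_zero (sub_ne_zero.mpr fun e => hz (hi e)) hz
  obtain ⟨δ, hδ, hball⟩ := Metric.isOpen_iff.mp
    (isOpen_image_of_injOn isOpen_ball hf.differentiableOn (hi.injOn (s := ball 0 1)))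
    (f 0) (mem_image_of_mem f (mem_ball_self one_pos))
  have hg : Differentiable ℂ fun z => (dslope f 0 z)⁻¹ := hd.inv hne
  obtain ⟨c, hc⟩ := eq_add_mul_of_norm_le hg (A := 0) (B := δ⁻¹) fun z hz => by
    have hz0 : z ≠ 0 := by rintro rfl; norm_num at hz
    have h1 : δ ≤ ‖f z - f 0‖ := by
      by_contra! hlt
      obtain ⟨y, hy, hyz⟩ := hball (mem_ball_iff_norm.mpr hlt)
      rw [hi hyz, mem_ball_zero_iff] at hy
      linarith
    rw [dslope_of_ne _ hz0, slope_def_field, sub_zero, inv_div, norm_div, zero_add, inv_mul_eq_div]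
    gcongr
  have hc0 : c = 0 := by
    by_contra h
    have := hc (-(dslope f 0 0)⁻¹ / c)
    rw [mul_div_cancel₀ _ h, add_neg_cancel] at this
    exact inv_ne_zero (hne _) this
  refine ⟨dslope f 0 0, hne 0, fun z => ?_⟩
  have h1 := hc z
  rw [hc0, zero_mul, add_zero, inv_inj] at h1
  have h2 := sub_smul_dslope f 0 z
  rw [h1, sub_zero, smul_eq_mul, mul_comm] at h2
  rw [h2]
  ring

theorem exists_separating_complex {f : ℂ → ℂ} (hf : Differentiable ℂ f)
    (hi : Function.Injective f) (hfix : ∀ z, f z ≠ z) {K : Set ℂ} (hK : IsCompact K) :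
    ∃ M : ℕ, ∀ m, M ≤ m → ∃ q : ℂ → ℂ, Differentiable ℂ q ∧
      (∀ z ∈ K, ‖q z‖ ≤ 1 / 10) ∧ ∀ z ∈ K, ‖q (f^[m] z) - 1‖ ≤ 1 / 10 := by
  obtain ⟨c, -, hc⟩ := exists_eq_add_mul_of_injective hf hi
  set b := f 0
  have hc1 : c = 1 := by
    by_contra h
    have h1 : 1 - c ≠ 0 := sub_ne_zero.mpr fun e => h e.symm
    refine hfix (b / (1 - c)) ?_
    rw [hc, eq_div_iff h1, add_mul, mul_assoc, div_mul_cancel₀ _ h1]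
    ring
  have hb : b ≠ 0 := hfix 0
  have hit : ∀ (m : ℕ) z, f^[m] z = z + m * b := by
    intro m z
    induction m with
    | zero => simp
    | succ m ih =>
      rw [Function.iterate_succ_apply', ih, hc, hc1]
      push_cast
      ring
  obtain ⟨C, hC⟩ := hK.exists_bound_of_continuousOn (f := fun z => z) continuousOn_id
  obtain ⟨N, hN⟩ := exists_nat_gt (10 * |C| / ‖b‖)
  have hb0 : 0 < ‖b‖ := norm_pos_iff.mpr hb
  rw [div_lt_iff₀ hb0] at hN
  refine ⟨N + 1, fun m hm => ?_⟩
  have hm' : (N : ℝ) + 1 ≤ m := by exact_mod_cast hm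
  have hm0 : (m : ℂ) * b ≠ 0 := mul_ne_zero (by norm_cast; omega) hb
  have hsmall : ∀ z ∈ K, ‖z / (m * b)‖ ≤ 1 / 10 := by
    intro z hz
    rw [norm_div, norm_mul, Complex.norm_natCast, div_le_iff₀ (by
      have : (0 : ℝ) < m := by linarith [(Nat.cast_nonneg N : (0 : ℝ) ≤ N)]
      positivity)]
    have := (hC z hz).trans (le_abs_self C)
    nlinarith
  refine ⟨fun z => z / (m * b), by fun_prop, hsmall, fun z hz => ?_⟩
  beta_reduce
  rw [hit, add_div, div_self hm0, add_sub_cancel_right]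
  exact hsmall z hz

theorem exists_leftInvOn_ball {X : Set ℂ} (hX : IsOpen X) (hXc : IsSimplyConnected X)
    (hne : X ≠ univ) :
    ∃ R S : ℂ → ℂ, DifferentiableOn ℂ R X ∧ DifferentiableOn ℂ S (ball 0 1) ∧
      MapsTo R X (ball 0 1) ∧ MapsTo S (ball 0 1) X ∧ LeftInvOn S R X ∧
      LeftInvOn R S (ball 0 1) := by
  obtain ⟨R, hR, hbij⟩ := exists_bijOn_ball hX hXc hne
  have hinv := hbij.invOn_invFunOn
  refine ⟨R, Function.invFunOn R X, hR, ?_, hbij.mapsTo, hbij.surjOn.mapsTo_invFunOn, hinv.1,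
    hinv.2⟩
  have := differentiableOn_of_leftInverse hX hR hbij.injOn hinv.1
  rwa [hbij.image_eq] at this

/-- High iterates of a fixed point free injective holomorphic self-map of a simply connected plane
domain can be separated from the identity on a compact set by a holomorphic function. -/
theorem exists_separating {X : Set ℂ} (hX : IsOpen X) (hXc : IsSimplyConnected X) {f : ℂ → ℂ}
    (hf : DifferentiableOn ℂ f X) (hm : MapsTo f X X) (hi : InjOn f X) (hfix : ∀ z ∈ X, f z ≠ z)
    {K : Set ℂ} (hK : IsCompact K) (hKX : K ⊆ X) :
    ∃ M : ℕ, ∀ m, M ≤ m → ∃ q : ℂ → ℂ, DifferentiableOn ℂ q X ∧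
      (∀ z ∈ K, ‖q z‖ ≤ 1 / 10) ∧ ∀ z ∈ K, ‖q (f^[m] z) - 1‖ ≤ 1 / 10 := by
  rcases eq_or_ne X univ with rfl | hne
  · obtain ⟨M, hM⟩ := exists_separating_complex (differentiableOn_univ.mp hf) (injOn_univ.mp hi)
      (fun z => hfix z (mem_univ z)) hK
    refine ⟨M, fun m hmM => ?_⟩
    obtain ⟨q, hq, h⟩ := hM m hmM
    exact ⟨q, hq.differentiableOn, h⟩
  obtain ⟨R, S, hR, hS, hRm, hSm, hSR, hRS⟩ := exists_leftInvOn_ball hX hXc hne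
  have hgm : MapsTo (R ∘ f ∘ S) (ball 0 1) (ball 0 1) := hRm.comp (hm.comp hSm)
  obtain ⟨M, hM⟩ := exists_separating_ball (f := R ∘ f ∘ S)
    (hR.comp (hf.comp hS hSm) (hm.comp hSm)) hgm
    (fun z hz h => hfix (S z) (hSm hz) (by
      rw [← hSR (hm (hSm hz))]
      exact congrArg S h))
    (hK.image_of_continuousOn (hR.continuousOn.mono hKX)) ((hRm.mono_left hKX).image_subset)
  have hit : ∀ (m : ℕ), ∀ z ∈ X, (R ∘ f ∘ S)^[m] (R z) = R (f^[m] z) := by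
    intro m z hz
    induction m with
    | zero => rfl
    | succ m ih =>
      rw [Function.iterate_succ_apply', Function.iterate_succ_apply', ih]
      simp only [Function.comp_apply]
      rw [hSR (hm.iterate m hz)]
  refine ⟨M, fun m hmM => ?_⟩
  obtain ⟨q, hq, h1, h2⟩ := hM m hmM
  refine ⟨q ∘ R, hq.comp hR hRm, fun z hz => h1 _ (mem_image_of_mem R hz), fun z hz => ?_⟩
  have := h2 _ (mem_image_of_mem R hz)
  rwa [hit m z (hKX hz)] at this

/-- On a simply connected plane domain, the entire functions of an injective holomorphic function
are dense in the holomorphic functions. -/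
theorem exists_near_comp_of_injOn {X : Set ℂ} (hX : IsOpen X) (hXc : IsSimplyConnected X)
    {φ G : ℂ → ℂ} (hφ : DifferentiableOn ℂ φ X) (hi : InjOn φ X) (hG : DifferentiableOn ℂ G X)
    {K : Set ℂ} (hK : IsCompact K) (hKX : K ⊆ X) {ε : ℝ} (hε : 0 < ε) :
    ∃ Q : ℂ → ℂ, Differentiable ℂ Q ∧ ∀ z ∈ K, ‖Q (φ z) - G z‖ < ε := by
  rcases eq_or_ne X univ with rfl | hne
  · rw [differentiableOn_univ] at hφ hG
    obtain ⟨c, hc0, hc⟩ := exists_eq_add_mul_of_injective hφ (injOn_univ.mp hi)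
    refine ⟨fun z => G ((z - φ 0) / c), hG.comp (by fun_prop), fun z _ => ?_⟩
    beta_reduce
    rw [hc z, add_sub_cancel_left, mul_div_cancel_left₀ _ hc0, sub_self, norm_zero]
    exact hε
  obtain ⟨R, S, hR, hS, hRm, hSm, hSR, hRS⟩ := exists_leftInvOn_ball hX hXc hne
  obtain ⟨Q, hQ⟩ := exists_polynomial_near_ball (hφ.comp hS hSm) (hi.comp hRS.injOn hSm)
    (hG.comp hS hSm) (hK.image_of_continuousOn (hR.continuousOn.mono hKX))
    ((hRm.mono_left hKX).image_subset) hε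
  refine ⟨fun z => Q.eval z, Q.differentiable, fun z hz => ?_⟩
  have := hQ _ (mem_image_of_mem R hz)
  simpa [hSR (hKX hz)] using this

/-- The cubic smoothing polynomial, with superattracting fixed points `0` and `1`. -/
noncomputable def smoothstep (z : ℂ) : ℂ := 3 * z ^ 2 - 2 * z ^ 3

theorem smoothstep_one_sub (z : ℂ) : smoothstep (1 - z) = 1 - smoothstep z := by
  simp only [smoothstep]
  ring

theorem norm_smoothstep_iterate_le {z : ℂ} (hz : ‖z‖ ≤ 1 / 10) (k : ℕ) :
    ‖smoothstep^[k] z‖ ≤ (1 / 2) ^ k * (1 / 10) := by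
  induction k with
  | zero => simpa using hz
  | succ k ih =>
    rw [Function.iterate_succ_apply']
    set x := smoothstep^[k] z
    have hx : ‖x‖ ≤ 1 / 10 := ih.trans (by
      have : ((1 : ℝ) / 2) ^ k ≤ 1 := pow_le_one₀ (by norm_num) (by norm_num)
      linarith)
    have h1 : ‖smoothstep x‖ ≤ 3 * ‖x‖ ^ 2 + 2 * ‖x‖ ^ 3 := by
      refine (norm_sub_le _ _).trans ?_
      simp
    have h2 : 3 * ‖x‖ ^ 2 + 2 * ‖x‖ ^ 3 ≤ 1 / 2 * ‖x‖ := by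
      have h0 := norm_nonneg x
      have : ‖x‖ ^ 2 ≤ ‖x‖ * (1 / 10) := by nlinarith
      have : ‖x‖ ^ 3 ≤ ‖x‖ * (1 / 10) := by nlinarith
      linarith
    rw [pow_succ]
    linarith

theorem smoothstep_iterate_one_sub (z : ℂ) (k : ℕ) :
    smoothstep^[k] (1 - z) = 1 - smoothstep^[k] z := by
  induction k with
  | zero => rfl
  | succ k ih => rw [Function.iterate_succ_apply', Function.iterate_succ_apply', ih,
      smoothstep_one_sub]

theorem differentiable_smoothstep_iterate (k : ℕ) : Differentiable ℂ smoothstep^[k] := by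
  refine Differentiable.iterate ?_ k
  unfold smoothstep
  fun_prop

/-- Simultaneous approximation on a compact set by a holomorphic function and by its weighted
composition with a high iterate. -/
theorem exists_near_and_near_iterate {X : Set ℂ} (hX : IsOpen X) (hXc : IsSimplyConnected X)
    {f : ℂ → ℂ} (hf : DifferentiableOn ℂ f X) (hm : MapsTo f X X) (hi : InjOn f X)
    (hfix : ∀ z ∈ X, f z ≠ z) {K : Set ℂ} (hK : IsCompact K) (hKX : K ⊆ X) :
    ∃ M : ℕ, ∀ m, M ≤ m → ∀ F G V : ℂ → ℂ, DifferentiableOn ℂ F X → DifferentiableOn ℂ G X →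
      DifferentiableOn ℂ V X → (∀ z ∈ X, V z ≠ 0) → ∀ ε > 0, ∃ H : ℂ → ℂ, DifferentiableOn ℂ H X ∧
        (∀ z ∈ K, ‖H z - F z‖ < ε) ∧ ∀ z ∈ K, ‖V z * H (f^[m] z) - G z‖ < ε := by
  obtain ⟨M, hM⟩ := exists_separating hX hXc hf hm hi hfix hK hKX
  refine ⟨M, fun m hmM F G V hF hG hV hV0 ε hε => ?_⟩
  obtain ⟨q, hq, hq1, hq2⟩ := hM m hmM
  have him : InjOn f^[m] X := hi.iterate hm m
  have hfm : DifferentiableOn ℂ f^[m] X := hf.iterate hm m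
  have hmm : MapsTo f^[m] X X := hm.iterate m
  obtain ⟨C₂, hC₂0, hC₂⟩ : ∃ C > 0, ∀ z ∈ K, ‖V z‖ ≤ C := by
    obtain ⟨C, hC⟩ := hK.exists_bound_of_continuousOn (hV.continuousOn.mono hKX)
    exact ⟨max C 1, by positivity, fun z hz => (hC z hz).trans (le_max_left _ _)⟩
  obtain ⟨Q, hQ, hQG⟩ := exists_near_comp_of_injOn hX hXc hfm him (hG.div hV hV0) hK hKX
    (show 0 < ε / (2 * C₂) by positivity)
  have hD : ContinuousOn (fun z => Q z - F z) X :=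
    hQ.continuous.continuousOn.sub hF.continuousOn
  obtain ⟨C₁, hC₁⟩ := hK.exists_bound_of_continuousOn (hD.mono hKX)
  obtain ⟨C₃, hC₃⟩ := hK.exists_bound_of_continuousOn
    ((hD.comp hfm.continuousOn hmm).mono hKX)
  obtain ⟨k, hk⟩ : ∃ k : ℕ, (1 / 2 : ℝ) ^ k * (|C₁| + C₂ * |C₃|) < ε / 2 := by
    have : Tendsto (fun k : ℕ => (1 / 2 : ℝ) ^ k * (|C₁| + C₂ * |C₃|)) atTop (𝓝 0) := by
      simpa using (tendsto_pow_atTop_nhds_zero_of_lt_one (by norm_num : (0 : ℝ) ≤ 1 / 2)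
        (by norm_num)).mul_const (|C₁| + C₂ * |C₃|)
    exact (this.eventually_lt_const (half_pos hε)).exists
  have hp : 0 ≤ (1 / 2 : ℝ) ^ k := by positivity
  rw [mul_add] at hk
  have hk1 : 0 ≤ (1 / 2 : ℝ) ^ k * |C₁| := by positivity
  have hk2 : 0 ≤ (1 / 2 : ℝ) ^ k * (C₂ * |C₃|) := by positivity
  set s : ℂ → ℂ := fun z => smoothstep^[k] (q z) with hs
  have hsd : DifferentiableOn ℂ s X :=
    (differentiable_smoothstep_iterate k).comp_differentiableOn hq
  refine ⟨fun z => F z + (Q z - F z) * s z,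
    hF.add ((hQ.differentiableOn.sub hF).mul hsd), fun z hz => ?_, fun z hz => ?_⟩
  · have h1 := norm_smoothstep_iterate_le (hq1 z hz) k
    rw [add_sub_cancel_left, norm_mul]
    calc ‖Q z - F z‖ * ‖s z‖ ≤ |C₁| * ((1 / 2) ^ k * (1 / 10)) := by
          gcongr
          exact (hC₁ z hz).trans (le_abs_self _)
      _ < ε := by linarith
  · have h1 : ‖1 - s (f^[m] z)‖ ≤ (1 / 2) ^ k * (1 / 10) := by
      rw [hs, ← smoothstep_iterate_one_sub]
      refine norm_smoothstep_iterate_le ?_ k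
      rw [norm_sub_rev]
      exact hq2 z hz
    have h2 : V z * (F (f^[m] z) + (Q (f^[m] z) - F (f^[m] z)) * s (f^[m] z)) - G z =
        V z * (Q (f^[m] z) - G z / V z) -
          V z * ((Q (f^[m] z) - F (f^[m] z)) * (1 - s (f^[m] z))) := by
      have : V z * (G z / V z) = G z := mul_div_cancel₀ _ (hV0 z (hKX hz))
      linear_combination this
    beta_reduce
    rw [h2]
    have h3 : ‖V z * (Q (f^[m] z) - G z / V z)‖ ≤ ε / 2 := by
      rw [norm_mul]
      calc ‖V z‖ * ‖Q (f^[m] z) - G z / V z‖ ≤ C₂ * (ε / (2 * C₂)) := by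
            gcongr
            · exact hC₂ z hz
            · exact (hQG z hz).le
        _ = ε / 2 := by field_simp
    have h4 : ‖V z * ((Q (f^[m] z) - F (f^[m] z)) * (1 - s (f^[m] z)))‖ < ε / 2 := by
      rw [norm_mul, norm_mul]
      calc ‖V z‖ * (‖Q (f^[m] z) - F (f^[m] z)‖ * ‖1 - s (f^[m] z)‖)
          ≤ C₂ * (|C₃| * ((1 / 2) ^ k * (1 / 10))) := by
            gcongr
            · exact hC₂ z hz
            · exact (hC₃ z hz).trans (le_abs_self _)
        _ < ε / 2 := by linarith
    linarith [norm_sub_le (V z * (Q (f^[m] z) - G z / V z))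
      (V z * ((Q (f^[m] z) - F (f^[m] z)) * (1 - s (f^[m] z))))]

/-- The zero-free solution `z ↦ exp (lam * conj z)` of `∂_z̄ u = lam * u`. -/
noncomputable def expConj (lam : ℂ) (z : ℂ) : ℂ := Complex.exp (lam * conj z)

theorem expConj_ne_zero (lam z : ℂ) : expConj lam z ≠ 0 := Complex.exp_ne_zero _

theorem expConj_neg_mul (lam z : ℂ) : expConj (-lam) z * expConj lam z = 1 := by
  rw [expConj, expConj, ← Complex.exp_add]
  simp

theorem contDiff_expConj (lam : ℂ) : ContDiff ℝ (⊤ : ℕ∞) (expConj lam) :=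
  (contDiff_const.mul Complex.conjCLE.contDiff).cexp

theorem continuous_expConj (lam : ℂ) : Continuous (expConj lam) := (contDiff_expConj lam).continuous

theorem dbar_expConj_mul (lam : ℂ) {g : ℂ → ℂ} {z : ℂ} (hg : DifferentiableAt ℝ g z) :
    dbar (fun u => expConj lam u * g u) z = expConj lam z * (lam * g z + dbar g z) := by
  have h1 : HasFDerivAt (fun u : ℂ => lam * conj u) (lam • (Complex.conjCLE : ℂ →L[ℝ] ℂ)) z :=
    (Complex.conjCLE : ℂ →L[ℝ] ℂ).hasFDerivAt.const_mul lam
  have h2 : HasFDerivAt (expConj lam)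
      (expConj lam z • (lam • (Complex.conjCLE : ℂ →L[ℝ] ℂ))) z := h1.cexp
  have h3 := h2.mul hg.hasFDerivAt
  have h4 : fderiv ℝ (fun u => expConj lam u * g u) z = _ := h3.fderiv
  have hI := Complex.I_mul_I
  rw [dbar, dbar, h4]
  simp only [add_apply, smul_apply, smul_eq_mul,
    ContinuousLinearEquiv.coe_coe, Complex.conjCLE_apply, map_one, Complex.conj_I]
  linear_combination (-(1 / 2 : ℂ) * expConj lam z * g z * lam) * hI

theorem differentiableAt_complex_iff_dbar_eq_zero {g : ℂ → ℂ} {z : ℂ}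
    (hg : DifferentiableAt ℝ g z) : DifferentiableAt ℂ g z ↔ dbar g z = 0 := by
  have hI := Complex.I_mul_I
  rw [differentiableAt_complex_iff_differentiableAt_real, and_iff_right hg, dbar, smul_eq_mul]
  constructor
  · intro h
    rw [h]
    linear_combination (1 / 2 * fderiv ℝ g z 1) * hI
  · intro h
    linear_combination (-2 * Complex.I) * h + fderiv ℝ g z Complex.I * hI

section Eigenspace

variable {lam : ℂ} {X : Set ℂ}

theorem mem_EigCR_iff (hX : IsOpen X) {f : C(↥X, ℂ)} :
    f ∈ EigCR lam X ↔
      ∃ F : ℂ → ℂ, DifferentiableOn ℂ F X ∧ ∀ z : ↥X, f z = expConj lam z * F z := by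
  constructor
  · rintro ⟨g, hg, hdb, hfg⟩
    refine ⟨fun z => expConj (-lam) z * g z, fun z hz => ?_, fun z => ?_⟩
    · have h1 : DifferentiableAt ℝ g z :=
        (hg.differentiableOn (by simp)).differentiableAt (hX.mem_nhds hz)
      have h2 : DifferentiableAt ℝ (fun z => expConj (-lam) z * g z) z :=
        ((contDiff_expConj (-lam)).differentiable (by simp) z).mul h1
      refine DifferentiableAt.differentiableWithinAt ?_
      rw [differentiableAt_complex_iff_dbar_eq_zero h2, dbar_expConj_mul _ h1, hdb z hz]
      ring
    · rw [hfg, ← mul_assoc, mul_comm (expConj lam _), expConj_neg_mul, one_mul]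
  · rintro ⟨F, hF, hfF⟩
    refine ⟨fun z => expConj lam z * F z, ?_, fun z hz => ?_, hfF⟩
    · exact (contDiff_expConj lam).contDiffOn.mul ((hF.contDiffOn hX).restrict_scalars ℝ)
    · have h1 := hF.differentiableAt (hX.mem_nhds hz)
      have h2 : DifferentiableAt ℝ F z := h1.restrictScalars ℝ
      rw [dbar_expConj_mul _ h2, (differentiableAt_complex_iff_dbar_eq_zero h2).mp h1]
      ring

/-- The element of the eigenspace with holomorphic part `F`. -/
theorem exists_mem_EigCR (hX : IsOpen X) {F : ℂ → ℂ} (hF : DifferentiableOn ℂ F X) :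
    ∃ f : ↥(EigCR lam X), ∀ z : ↥X, f.1 z = expConj lam z * F z :=
  ⟨⟨⟨fun z => expConj lam z * F z, ((continuous_expConj lam).continuousOn.mul
    hF.continuousOn).domRestrict⟩, (mem_EigCR_iff hX).mpr ⟨F, hF, fun _ => rfl⟩⟩, fun _ => rfl⟩

theorem isClosed_EigCR (hX : IsOpen X) : IsClosed (EigCR lam X) := by
  have := hX.locallyCompactSpace
  let e : C(↥X, ℂ) := ⟨fun z => expConj (-lam) z, by
    exact (continuous_expConj _).comp continuous_subtype_val⟩
  have hcont : Continuous fun f : C(↥X, ℂ) => e * f := continuous_const.mul continuous_id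
  classical
  let ext : C(↥X, ℂ) → ℂ → ℂ := fun f z => if h : z ∈ X then f ⟨z, h⟩ else 0
  have hext : ∀ f (z : ↥X), ext f z = f z := fun f z => by simp [ext]
  have hiff : ∀ f : C(↥X, ℂ), f ∈ EigCR lam X ↔ DifferentiableOn ℂ (ext (e * f)) X := by
    intro f
    rw [mem_EigCR_iff hX]
    constructor
    · rintro ⟨F, hF, h⟩
      refine hF.congr fun z hz => ?_
      rw [hext (e * f) ⟨z, hz⟩, ContinuousMap.mul_apply, h]
      change expConj (-lam) z * (expConj lam z * F z) = F z
      rw [← mul_assoc, expConj_neg_mul, one_mul]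
    · intro h
      refine ⟨_, h, fun z => ?_⟩
      rw [hext, ContinuousMap.mul_apply]
      change f z = expConj lam z * (expConj (-lam) z * f z)
      rw [← mul_assoc, mul_comm (expConj lam _), expConj_neg_mul, one_mul]
  refine isClosed_of_closure_subset fun f hf => ?_
  rw [hiff]
  have := mem_closure_iff_nhdsWithin_neBot.mp hf
  have hlim : Tendsto (fun h : C(↥X, ℂ) => e * h) (𝓝[EigCR lam X] f) (𝓝 (e * f)) :=
    (hcont.tendsto f).mono_left nhdsWithin_le_nhds
  rw [ContinuousMap.tendsto_iff_tendstoLocallyUniformly] at hlim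
  have hl : TendstoLocallyUniformlyOn (fun h z => ext (e * h) z) (ext (e * f))
      (𝓝[EigCR lam X] f) X := by
    rw [tendstoLocallyUniformlyOn_iff_tendstoLocallyUniformly_comp_coe]
    simpa only [hext, Function.comp_def] using hlim
  refine hl.differentiableOn ?_ hX
  filter_upwards [self_mem_nhdsWithin] with h hh
  exact (hiff h).mp hh

/-- Neighbourhoods in the compact-open topology contain uniform neighbourhoods on compact sets. -/
theorem exists_isCompact_forall_norm_sub_lt {U : Set ↥(EigCR lam X)} (hU : IsOpen U)
    {f : ↥(EigCR lam X)} (hf : f ∈ U) :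
    ∃ K ⊆ X, IsCompact K ∧ ∃ ε > 0, ∀ h : ↥(EigCR lam X),
      (∀ z : ↥X, (z : ℂ) ∈ K → ‖h.1 z - f.1 z‖ < ε) → h ∈ U := by
  obtain ⟨U', hU', rfl⟩ := isOpen_induced_iff.mp hU
  have h1 : U' ∈ 𝓝 f.1 := hU'.mem_nhds hf
  obtain ⟨⟨K, S⟩, ⟨hK, hS⟩, hKS⟩ :=
    (ContinuousMap.hasBasis_compactConvergenceUniformity.mem_iff).mp
      (show {p : C(↥X, ℂ) × C(↥X, ℂ) | p.1 = f.1 → p.2 ∈ U'} ∈ uniformity C(↥X, ℂ) from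
        UniformSpace.mem_nhds_iff_symm.mp h1 |>.elim fun V hV =>
          mem_of_superset hV.1 fun p hp hpf => hV.2.2 (by rw [← hpf]; exact hp))
  obtain ⟨ε, hε, hεS⟩ := Metric.mem_uniformity_dist.mp hS
  refine ⟨(↑) '' K, by rintro _ ⟨z, -, rfl⟩; exact z.2, hK.image continuous_subtype_val, ε, hε,
    fun h hh => ?_⟩
  refine hKS (show (f.1, h.1) ∈ _ from fun x hx => hεS ?_) rfl
  rw [dist_comm, dist_eq_norm]
  exact hh x (mem_image_of_mem _ hx)

end Eigenspace

theorem TopMixing.topWeaklyMixing {E : Type*} [TopologicalSpace E] {T : E → E} (h : TopMixing T) :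
    TopWeaklyMixing T := by
  intro U₁ U₂ V₁ V₂ hU₁ hU₂ hV₁ hV₂ hU₁' hU₂' hV₁' hV₂'
  obtain ⟨M₁, h₁⟩ := h U₁ V₁ hU₁ hV₁ hU₁' hV₁'
  obtain ⟨M₂, h₂⟩ := h U₂ V₂ hU₂ hV₂ hU₂' hV₂'
  exact ⟨max M₁ M₂ + 1, by omega, h₁ _ (by omega), h₂ _ (by omega)⟩

/-- **Birkhoff's transitivity theorem**, for mixing maps. -/
theorem TopMixing.hypercyclic {E : Type*} [TopologicalSpace E] [BaireSpace E]
    [SecondCountableTopology E] [Nonempty E] {T : E → E} (hT : Continuous T) (h : TopMixing T) :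
    Hypercyclic T := by
  obtain ⟨B, hBc, hBne, hB⟩ := TopologicalSpace.exists_countable_basis E
  have hd : Dense (⋂ V ∈ B, ⋃ m : ℕ, T^[m] ⁻¹' V) := by
    refine dense_biInter_of_isOpen
      (fun V hV => isOpen_iUnion fun m => (hB.isOpen hV).preimage (hT.iterate m)) hBc
      fun V hV => ?_
    rw [dense_iff_inter_open]
    intro U hU hUne
    have hVne : V.Nonempty := nonempty_iff_ne_empty.mpr fun e => hBne (e ▸ hV)
    obtain ⟨M, hM⟩ := h U V hU (hB.isOpen hV) hUne hVne
    obtain ⟨_, ⟨x, hx, rfl⟩, hxV⟩ := hM M le_rfl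
    exact ⟨x, hx, mem_iUnion.mpr ⟨M, hxV⟩⟩
  obtain ⟨x, hx⟩ := hd.nonempty
  refine ⟨x, ?_⟩
  rw [hB.dense_iff]
  intro V hV _
  obtain ⟨m, hm⟩ := mem_iUnion.mp (mem_iInter₂.mp hx V hV)
  exact ⟨_, hm, m, rfl⟩

theorem TopWeaklyMixing.exists_map_mem {E : Type*} [TopologicalSpace E] {T : E → E}
    (h : TopWeaklyMixing T) {V : Set E} (hV : IsOpen V) (hne : V.Nontrivial) : ∃ x, T x ∈ V := by
  have hE : (univ : Set E).Nonempty := ⟨_, mem_univ hne.nonempty.some⟩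
  obtain ⟨m, hm, ⟨_, ⟨x, -, rfl⟩, hx⟩, -⟩ := h univ univ V V isOpen_univ isOpen_univ hV hV hE hE
    hne.nonempty hne.nonempty
  obtain ⟨n, rfl⟩ := Nat.exists_eq_add_of_le' hm
  rw [Function.iterate_succ_apply'] at hx
  exact ⟨_, hx⟩

theorem Hypercyclic.exists_map_mem {E : Type*} [TopologicalSpace E] [T1Space E] {T : E → E}
    (h : Hypercyclic T) {V : Set E} (hV : IsOpen V) (hne : V.Nontrivial) : ∃ x, T x ∈ V := by
  obtain ⟨x, hx⟩ := h
  obtain ⟨y, hy, hyx⟩ := hne.exists_ne x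
  obtain ⟨_, ⟨hz, hzx⟩, ⟨m, rfl⟩⟩ := hx.inter_open_nonempty (V ∩ {x}ᶜ)
    (hV.inter isOpen_compl_singleton) ⟨y, hy, hyx⟩
  cases m with
  | zero => exact absurd rfl hzx
  | succ m =>
    refine ⟨T^[m] x, ?_⟩
    rw [← Function.iterate_succ_apply' T m x]
    exact hz

section Operator

variable {lam : ℂ} {X : Set ℂ} {w ψ : ℂ → ℂ} {hm : MapsTo ψ X X}
  {T : ↥(EigCR lam X) → ↥(EigCR lam X)}

/-- The holomorphic part of an element of the eigenspace, at a point of `X`. -/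
noncomputable def holPart (z : ↥X) (f : ↥(EigCR lam X)) : ℂ := expConj (-lam) z * f.1 z

theorem continuous_holPart (z : ↥X) : Continuous (holPart (lam := lam) z) :=
  continuous_const.mul ((continuous_eval_const z).comp continuous_subtype_val)

theorem apply_eq_expConj_mul_holPart (z : ↥X) (f : ↥(EigCR lam X)) :
    f.1 z = expConj lam z * holPart z f := by
  rw [holPart, ← mul_assoc, mul_comm (expConj lam _), expConj_neg_mul, one_mul]

theorem holPart_eq {z : ↥X} {f : ↥(EigCR lam X)} {c : ℂ} (h : f.1 z = expConj lam z * c) :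
    holPart z f = c := by
  rw [holPart, h, ← mul_assoc, expConj_neg_mul, one_mul]

theorem exists_holPart_eq (hX : IsOpen X) {F : ℂ → ℂ} (hF : DifferentiableOn ℂ F X) :
    ∃ f : ↥(EigCR lam X), ∀ z : ↥X, holPart z f = F z :=
  (exists_mem_EigCR hX hF).imp fun _ h z => holPart_eq (h z)

theorem exists_differentiableOn_holPart (hX : IsOpen X) (f : ↥(EigCR lam X)) :
    ∃ F : ℂ → ℂ, DifferentiableOn ℂ F X ∧ ∀ z : ↥X, holPart z f = F z := by
  obtain ⟨F, hF, h⟩ := (mem_EigCR_iff hX).mp f.2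
  exact ⟨F, hF, fun z => holPart_eq (h z)⟩

/-- The weight acting on holomorphic parts. -/
noncomputable def holWeight (lam : ℂ) (w ψ : ℂ → ℂ) (z : ℂ) : ℂ :=
  expConj (-lam) z * (w z * expConj lam (ψ z))

theorem holWeight_eq_zero_iff {z : ℂ} : holWeight lam w ψ z = 0 ↔ w z = 0 := by
  simp [holWeight, expConj_ne_zero]

theorem holPart_map (hT : ∀ f (z : ↥X), (T f).1 z = w z * f.1 ⟨ψ z, hm z.2⟩) (z : ↥X)
    (f : ↥(EigCR lam X)) :
    holPart z (T f) = holWeight lam w ψ z * holPart ⟨ψ z, hm z.2⟩ f := by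
  rw [holPart, hT, apply_eq_expConj_mul_holPart, holWeight]
  ring

theorem holPart_iterate (hT : ∀ f (z : ↥X), (T f).1 z = w z * f.1 ⟨ψ z, hm z.2⟩) (m : ℕ) (z : ↥X)
    (f : ↥(EigCR lam X)) :
    holPart z (T^[m] f) =
      (∏ j ∈ Finset.range m, holWeight lam w ψ (ψ^[j] z)) * holPart ⟨ψ^[m] z, hm.iterate m z.2⟩ f := by
  induction m generalizing f with
  | zero => simp
  | succ m ih =>
    rw [Function.iterate_succ_apply, ih, holPart_map hT, Finset.prod_range_succ, mul_assoc]
    simp only [Function.iterate_succ_apply']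

theorem differentiableOn_holWeight (hX : IsOpen X)
    (hT : ∀ f (z : ↥X), (T f).1 z = w z * f.1 ⟨ψ z, hm z.2⟩) :
    DifferentiableOn ℂ (holWeight lam w ψ) X := by
  obtain ⟨f, hf⟩ := exists_holPart_eq (lam := lam) hX (differentiableOn_const (1 : ℂ))
  obtain ⟨F, hF, h⟩ := exists_differentiableOn_holPart hX (T f)
  refine hF.congr fun z hz => ?_
  rw [← h ⟨z, hz⟩, holPart_map hT, hf, mul_one]

theorem differentiableOn_of_forall_ne_zero (hX : IsOpen X)
    (hT : ∀ f (z : ↥X), (T f).1 z = w z * f.1 ⟨ψ z, hm z.2⟩) (hw : ∀ z ∈ X, w z ≠ 0) :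
    DifferentiableOn ℂ ψ X := by
  obtain ⟨f, hf⟩ := exists_holPart_eq (lam := lam) hX differentiableOn_id
  obtain ⟨F, hF, h⟩ := exists_differentiableOn_holPart hX (T f)
  have h0 : ∀ z ∈ X, holWeight lam w ψ z ≠ 0 := fun z hz => holWeight_eq_zero_iff.not.mpr (hw z hz)
  refine (hF.div (differentiableOn_holWeight hX hT) h0).congr fun z hz => ?_
  rw [Pi.div_apply, eq_div_iff (h0 z hz), ← h ⟨z, hz⟩, holPart_map hT, hf]
  exact mul_comm _ _

theorem topMixing_of_injOn (hX : IsOpen X) (hXc : IsSimplyConnected X)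
    (hT : ∀ f (z : ↥X), (T f).1 z = w z * f.1 ⟨ψ z, hm z.2⟩) (hw : ∀ z ∈ X, w z ≠ 0)
    (hi : InjOn ψ X) (hfix : ∀ z ∈ X, ψ z ≠ z) : TopMixing T := by
  rintro U V hU hV ⟨f, hf⟩ ⟨g, hg⟩
  obtain ⟨K₁, hK₁X, hK₁, ε₁, hε₁, h₁⟩ := exists_isCompact_forall_norm_sub_lt hU hf
  obtain ⟨K₂, hK₂X, hK₂, ε₂, hε₂, h₂⟩ := exists_isCompact_forall_norm_sub_lt hV hg
  have hψ := differentiableOn_of_forall_ne_zero hX hT hw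
  have hW := differentiableOn_holWeight hX hT
  obtain ⟨F, hF, hfF⟩ := exists_differentiableOn_holPart hX f
  obtain ⟨G, hG, hgG⟩ := exists_differentiableOn_holPart hX g
  have hK := hK₁.union hK₂
  obtain ⟨C, hC⟩ := hK.exists_bound_of_continuousOn (continuous_expConj lam).continuousOn
  set ε := min ε₁ ε₂ / (|C| + 1) with hε
  have hmin : 0 < min ε₁ ε₂ := lt_min hε₁ hε₂
  have hε0 : 0 < ε := by positivity
  have hbd : ∀ z ∈ K₁ ∪ K₂, ∀ x, ‖x‖ < ε → ‖expConj lam z * x‖ < min ε₁ ε₂ := by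
    intro z hz x hx
    rw [hε, lt_div_iff₀ (by positivity)] at hx
    rw [norm_mul]
    refine lt_of_le_of_lt ?_ hx
    rw [mul_comm]
    gcongr
    linarith [hC z hz, le_abs_self C]
  obtain ⟨M, hM⟩ := exists_near_and_near_iterate hX hXc hψ hm hi hfix hK
    (union_subset hK₁X hK₂X)
  refine ⟨M, fun m hmM => ?_⟩
  obtain ⟨H, hH, hHF, hHG⟩ := hM m hmM F G
    (fun z => ∏ j ∈ Finset.range m, holWeight lam w ψ (ψ^[j] z)) hF hG
    (DifferentiableOn.fun_finsetProd fun j _ => hW.comp (hψ.iterate hm j) (hm.iterate j))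
    (fun z hz => Finset.prod_ne_zero_iff.mpr fun j _ =>
      holWeight_eq_zero_iff.not.mpr (hw _ (hm.iterate j hz))) ε hε0
  obtain ⟨h, hh⟩ := exists_holPart_eq (lam := lam) hX hH
  refine ⟨T^[m] h, ⟨h, h₁ h fun z hz => ?_, rfl⟩, h₂ _ fun z hz => ?_⟩
  · rw [apply_eq_expConj_mul_holPart z h, apply_eq_expConj_mul_holPart z f, ← mul_sub, hh, hfF]
    exact (hbd z (.inl hz) _ (hHF z (.inl hz))).trans_le (min_le_left _ _)
  · rw [apply_eq_expConj_mul_holPart z, apply_eq_expConj_mul_holPart z g, ← mul_sub, hgG,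
      holPart_iterate hT, hh]
    exact (hbd z (.inr hz) _ (hHG z (.inr hz))).trans_le (min_le_right _ _)

theorem forall_ne_zero_of_exists_map_mem (hX : IsOpen X)
    (hT : ∀ f (z : ↥X), (T f).1 z = w z * f.1 ⟨ψ z, hm z.2⟩)
    (hr : ∀ V : Set ↥(EigCR lam X), IsOpen V → V.Nontrivial → ∃ f, T f ∈ V) :
    ∀ z ∈ X, w z ≠ 0 := by
  intro z hz hwz
  obtain ⟨f, hf⟩ := exists_holPart_eq (lam := lam) hX (differentiableOn_const (1 : ℂ))
  obtain ⟨g, hg⟩ := exists_holPart_eq (lam := lam) hX (differentiableOn_const (2 : ℂ))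
  obtain ⟨h, hh⟩ := hr ((holPart ⟨z, hz⟩) ⁻¹' {0}ᶜ)
    (isOpen_compl_singleton.preimage (continuous_holPart _))
    ⟨f, by simp [hf], g, by simp [hg], fun e => by
      have := congrArg (holPart ⟨z, hz⟩) e
      rw [hf, hg] at this
      norm_num at this⟩
  refine hh ?_
  rw [mem_singleton_iff, holPart_map hT, holWeight_eq_zero_iff.mpr hwz, zero_mul]

theorem injOn_of_exists_map_mem (hX : IsOpen X)
    (hT : ∀ f (z : ↥X), (T f).1 z = w z * f.1 ⟨ψ z, hm z.2⟩)
    (hr : ∀ V : Set ↥(EigCR lam X), IsOpen V → V.Nontrivial → ∃ f, T f ∈ V) : InjOn ψ X := by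
  intro a ha b hb hab
  by_contra hne
  have hW : holWeight lam w ψ a ≠ 0 :=
    holWeight_eq_zero_iff.not.mpr (forall_ne_zero_of_exists_map_mem hX hT hr a ha)
  have hba : b - a ≠ 0 := sub_ne_zero.mpr (Ne.symm hne)
  obtain ⟨f, hf⟩ := exists_holPart_eq (lam := lam) hX
    (show DifferentiableOn ℂ (fun z => z - a) X by fun_prop)
  obtain ⟨g, hg⟩ := exists_holPart_eq (lam := lam) hX
    (show DifferentiableOn ℂ (fun z => 2 * (z - a)) X by fun_prop)
  obtain ⟨h, hh⟩ := hr ((fun f => holPart ⟨a, ha⟩ f * holWeight lam w ψ b -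
      holPart ⟨b, hb⟩ f * holWeight lam w ψ a) ⁻¹' {0}ᶜ)
    (isOpen_compl_singleton.preimage (((continuous_holPart _).mul continuous_const).sub
      ((continuous_holPart _).mul continuous_const)))
    ⟨f, by simp [hf, hW, hba], g, by simp [hg, hW, hba], fun e => by
      have := congrArg (holPart ⟨b, hb⟩) e
      rw [hf, hg] at this
      exact hba (by linear_combination -this)⟩
  refine hh ?_
  rw [mem_singleton_iff]
  beta_reduce
  rw [holPart_map hT, holPart_map hT]
  simp only [hab]
  ring

theorem holPart_iterate_of_fixed (hT : ∀ f (z : ↥X), (T f).1 z = w z * f.1 ⟨ψ z, hm z.2⟩)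
    {a : ↥X} (ha : ψ a = a) (m : ℕ) (f : ↥(EigCR lam X)) :
    holPart a (T^[m] f) = holWeight lam w ψ a ^ m * holPart a f := by
  induction m with
  | zero => simp
  | succ m ih =>
    rw [Function.iterate_succ_apply', holPart_map hT]
    simp only [ha, ih]
    ring

theorem isOpen_norm_holPart_lt (a : ↥X) (r : ℝ) :
    IsOpen {f : ↥(EigCR lam X) | ‖holPart a f‖ < r} :=
  isOpen_lt (continuous_holPart a).norm continuous_const

theorem isOpen_lt_norm_holPart (a : ↥X) (r : ℝ) :
    IsOpen {f : ↥(EigCR lam X) | r < ‖holPart a f‖} :=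
  isOpen_lt continuous_const (continuous_holPart a).norm

theorem exists_norm_holPart_eq (hX : IsOpen X) (a : ↥X) {r : ℝ} (hr : 0 ≤ r) :
    ∃ f : ↥(EigCR lam X), ‖holPart a f‖ = r := by
  obtain ⟨f, hf⟩ := exists_holPart_eq (lam := lam) hX (differentiableOn_const (r : ℂ))
  exact ⟨f, by rw [hf, Complex.norm_real, Real.norm_of_nonneg hr]⟩

theorem TopWeaklyMixing.forall_ne (h : TopWeaklyMixing T) (hX : IsOpen X)
    (hT : ∀ f (z : ↥X), (T f).1 z = w z * f.1 ⟨ψ z, hm z.2⟩) : ∀ z ∈ X, ψ z ≠ z := by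
  intro z hz hfix
  set a : ↥X := ⟨z, hz⟩
  obtain ⟨f, hf⟩ := exists_norm_holPart_eq (lam := lam) hX a (r := 0) le_rfl
  obtain ⟨g, hg⟩ := exists_norm_holPart_eq (lam := lam) hX a (r := 2) zero_le_two
  have hlt : {f : ↥(EigCR lam X) | ‖holPart a f‖ < 1}.Nonempty := ⟨f, by simp [hf]⟩
  have hgt : {f : ↥(EigCR lam X) | 1 < ‖holPart a f‖}.Nonempty := ⟨g, by simp [hg]⟩
  obtain ⟨m, -, ⟨_, ⟨x, hx, rfl⟩, hx'⟩, ⟨_, ⟨y, hy, rfl⟩, hy'⟩⟩ := h _ _ _ _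
    (isOpen_norm_holPart_lt a 1) (isOpen_lt_norm_holPart a 1)
    (isOpen_lt_norm_holPart a 1) (isOpen_norm_holPart_lt a 1) hlt hgt hgt hlt
  have hfa : ψ a = a := hfix
  simp only [mem_ofPred_eq, holPart_iterate_of_fixed hT hfa, norm_mul] at hx hx' hy hy'
  rcases le_total ‖holWeight lam w ψ a ^ m‖ 1 with h1 | h1
  · nlinarith [norm_nonneg (holPart a x)]
  · nlinarith [norm_nonneg (holPart a y)]

theorem Hypercyclic.forall_ne (h : Hypercyclic T) (hX : IsOpen X)
    (hT : ∀ f (z : ↥X), (T f).1 z = w z * f.1 ⟨ψ z, hm z.2⟩) : ∀ z ∈ X, ψ z ≠ z := by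
  intro z hz hfix
  set a : ↥X := ⟨z, hz⟩
  have hfa : ψ a = a := hfix
  obtain ⟨x, hx⟩ := h
  set W := holWeight lam w ψ a
  by_cases hc : 1 < ‖W‖ ∧ 0 < ‖holPart a x‖
  · obtain ⟨f, hf⟩ := exists_norm_holPart_eq (lam := lam) hX a (r := 0) le_rfl
    obtain ⟨_, hlt, ⟨m, rfl⟩⟩ := hx.inter_open_nonempty _
      (isOpen_norm_holPart_lt a ‖holPart a x‖) ⟨f, by simpa [hf] using hc.2⟩
    simp only [mem_ofPred_eq, holPart_iterate_of_fixed hT hfa, norm_mul, norm_pow] at hlt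
    have : 1 ≤ ‖W‖ ^ m := one_le_pow₀ hc.1.le
    nlinarith [hc.2]
  · obtain ⟨f, hf⟩ := exists_norm_holPart_eq (lam := lam) hX a (r := ‖holPart a x‖ + 1)
      (by positivity)
    obtain ⟨_, hgt, ⟨m, rfl⟩⟩ := hx.inter_open_nonempty _
      (isOpen_lt_norm_holPart a ‖holPart a x‖) ⟨f, by simp [hf]⟩
    simp only [mem_ofPred_eq, holPart_iterate_of_fixed hT hfa, norm_mul, norm_pow] at hgt
    rcases not_and_or.mp hc with h1 | h1
    · have : ‖W‖ ^ m ≤ 1 := pow_le_one₀ (norm_nonneg _) (not_lt.mp h1)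
      nlinarith [norm_nonneg (holPart a x)]
    · rw [le_antisymm (not_lt.mp h1) (norm_nonneg _)] at hgt
      simp at hgt

theorem nonempty_EigCR (hX : IsOpen X) : Nonempty ↥(EigCR lam X) :=
  ⟨(exists_mem_EigCR hX (differentiableOn_const (0 : ℂ))).choose⟩

end Operator

theorem continuous_wcompC {X : Set ℂ} {w ψ : ℂ → ℂ} (hX : IsOpen X)
    (hw : ContinuousOn w X) (hψ : ContinuousOn ψ X) (hm : MapsTo ψ X X) :
    Continuous (wcompC X w ψ hw hψ hm) := by
  have := hX.locallyCompactSpace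
  let a : C(↥X, ℂ) := ⟨X.domRestrict w, hw.domRestrict⟩
  let b : C(↥X, ↥X) := ⟨fun x => ⟨ψ x, hm x.2⟩, hψ.domRestrict.subtype_mk fun x => hm x.2⟩
  exact continuous_const.mul (ContinuousMap.continuous_precomp b) (f := fun _ => a)

end

/-- for `λ ∈ ℂ`, `X ⊆ ℂ` open and homeomorphic to `ℝ² = ℂ`, and smooth `w`, `ψ`
such that `C_{w,ψ}` maps `E_λ(X) = {f : ∂_z̄ f = λf}` into itself, the following are
equivalent: mixing; weak mixing; `w` has no zeros, `ψ` is injective, holomorphic and has no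
fixed point. If moreover `|w| ≤ 1`, these are equivalent to hypercyclicity. -/
theorem stmt17 (lam : ℂ) (X : Set ℂ) (hXopen : IsOpen X)
    (hhomeo : Nonempty (↥X ≃ₜ ℂ))
    (w ψ : ℂ → ℂ)
    (hw : ContDiffOn ℝ (⊤ : ℕ∞) w X) (hψ : ContDiffOn ℝ (⊤ : ℕ∞) ψ X)
    (hm : Set.MapsTo ψ X X)
    (hwd : Set.MapsTo (wcompC X w ψ hw.continuousOn hψ.continuousOn hm)
      (EigCR lam X) (EigCR lam X)) :
    (TopMixing (Set.MapsTo.restrict _ _ _ hwd) ↔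
      TopWeaklyMixing (Set.MapsTo.restrict _ _ _ hwd)) ∧
    (TopWeaklyMixing (Set.MapsTo.restrict _ _ _ hwd) ↔
      ((∀ z ∈ X, w z ≠ 0) ∧ Set.InjOn ψ X ∧ (∀ z ∈ X, dbar ψ z = 0) ∧
        ∀ z ∈ X, ψ z ≠ z)) ∧
    ((∀ z ∈ X, ‖w z‖ ≤ 1) →
      (TopWeaklyMixing (Set.MapsTo.restrict _ _ _ hwd) ↔
        Hypercyclic (Set.MapsTo.restrict _ _ _ hwd))) := by
  obtain ⟨e⟩ := hhomeo
  have hXc : IsSimplyConnected X :=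
    have := e.contractibleSpace
    SimplyConnectedSpace.ofContractible ↥X
  set T := Set.MapsTo.restrict _ _ _ hwd with hTdef
  have hT : ∀ f (z : ↥X), (T f).1 z = w z * f.1 ⟨ψ z, hm z.2⟩ := fun f z => rfl
  have hmix : ((∀ z ∈ X, w z ≠ 0) ∧ Set.InjOn ψ X ∧ ∀ z ∈ X, ψ z ≠ z) → TopMixing T :=
    fun h => topMixing_of_injOn hXopen hXc hT h.1 h.2.1 h.2.2
  have hdbar : (∀ z ∈ X, w z ≠ 0) → ∀ z ∈ X, dbar ψ z = 0 := fun h z hz => by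
    have hd := (differentiableOn_of_forall_ne_zero hXopen hT h).differentiableAt
      (hXopen.mem_nhds hz)
    exact (differentiableAt_complex_iff_dbar_eq_zero (hd.restrictScalars ℝ)).mp hd
  have hwm : TopWeaklyMixing T →
      (∀ z ∈ X, w z ≠ 0) ∧ Set.InjOn ψ X ∧ ∀ z ∈ X, ψ z ≠ z := fun h =>
    ⟨forall_ne_zero_of_exists_map_mem hXopen hT fun _ => h.exists_map_mem,
      injOn_of_exists_map_mem hXopen hT fun _ => h.exists_map_mem, h.forall_ne hXopen hT⟩
  have hhc : Hypercyclic T →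
      (∀ z ∈ X, w z ≠ 0) ∧ Set.InjOn ψ X ∧ ∀ z ∈ X, ψ z ≠ z := fun h =>
    ⟨forall_ne_zero_of_exists_map_mem hXopen hT fun _ => h.exists_map_mem,
      injOn_of_exists_map_mem hXopen hT fun _ => h.exists_map_mem, h.forall_ne hXopen hT⟩
  refine ⟨⟨TopMixing.topWeaklyMixing, fun h => hmix (hwm h)⟩,
    ⟨fun h => ⟨(hwm h).1, (hwm h).2.1, hdbar (hwm h).1, (hwm h).2.2⟩,
      fun h => (hmix ⟨h.1, h.2.1, h.2.2.2⟩).topWeaklyMixing⟩,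
    fun _ => ⟨fun h => ?_, fun h => (hmix (hhc h)).topWeaklyMixing⟩⟩
  have := hXopen.locallyCompactSpace
  have : CompleteSpace ↥(EigCR lam X) := (isClosed_EigCR hXopen).completeSpace_coe
  have := nonempty_EigCR (lam := lam) hXopen
  have : BaireSpace ↥(EigCR lam X) := inferInstance
  exact (hmix (hwm h)).hypercyclic
    ((continuous_wcompC hXopen _ _ _).restrict hwd)
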